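/- For every finite simple graph G containing no clique on r+1 vertices, there exists a simplicial complex C that is r-colorable and satisfies c_i(C) = c_i(G) for every i ≥ 0. -/

import Mathlib

/-- A family of finsets of `Fin n` is a simplicial complex on the vertex set `Fin n` if it
contains the empty set, all singletons, and is closed under taking subsets. -/
def IsSimplicialComplex {n : ℕ} (C : Finset (Finset (Fin n))) : Prop :=
  ∅ ∈ C ∧ (∀ v : Fin n, {v} ∈ C) ∧ ∀ s ∈ C, ∀ t ⊆ s, t ∈ C

/-- The `i`-th face number of a complex: the number of faces with exactly `i` vertices. -/
def faceCount {n : ℕ} (C : Finset (Finset (Fin n))) (i : ℕ) : ℕ :=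
  (C.filter fun s => s.card = i).card

/-- A complex is `r`-colorable if its vertices can be colored by `r` colors so that the
coloring is injective on every face. -/
def ComplexColorable {n : ℕ} (C : Finset (Finset (Fin n))) (r : ℕ) : Prop :=
  ∃ f : Fin n → Fin r, ∀ s ∈ C, Set.InjOn f ↑s


namespace Frohm
open Finset

/-- Binary weight of a finite set of naturals; it induces the colex order. -/
def wt (A : Finset ℕ) : ℕ := ∑ x ∈ A, 2 ^ x

lemma wt_lt_of {A B : Finset ℕ} {d : ℕ} (hB : d ∈ B) (hA : d ∉ A)
    (h : ∀ e, d < e → e ∈ A → e ∈ B) : wt A < wt B := by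
  unfold wt
  rw [Finset.geomSum_lt_geomSum_iff_toColex_lt_toColex le_rfl,
    Finset.Colex.toColex_lt_toColex_iff_exists_forall_lt]
  refine ⟨d, hB, hA, ?_⟩
  intro b hb hb'
  by_contra hlt
  rcases (not_lt.mp hlt).eq_or_lt with h1 | h1
  · exact hA (h1 ▸ hb)
  · exact hb' (h b h1 hb)

lemma wt_inj {A B : Finset ℕ} (h : wt A = wt B) : A = B :=
  Finset.geomSum_injective (n := 2) le_rfl h

lemma wt_lt_exists {A B : Finset ℕ} (h : wt A < wt B) :
    ∃ d ∈ B, d ∉ A ∧ ∀ e, d < e → (e ∈ A ↔ e ∈ B) := by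
  unfold wt at h
  rw [Finset.geomSum_lt_geomSum_iff_toColex_lt_toColex le_rfl,
    Finset.Colex.lt_iff_exists_filter_lt] at h
  obtain ⟨w, hw, h2⟩ := h
  rw [Finset.mem_sdiff] at hw
  refine ⟨w, hw.1, hw.2, fun e he => ?_⟩
  have := Finset.ext_iff.mp h2 e
  simp only [Finset.mem_filter] at this
  tauto

lemma wt_singleton (t : ℕ) : wt {t} = 2 ^ t := by simp [wt]

lemma wt_lt_pow {A : Finset ℕ} {t : ℕ} (h : ∀ x ∈ A, x < t) : wt A < 2 ^ t := by
  rw [← wt_singleton]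
  apply wt_lt_of (d := t) (by simp)
  · intro h'; exact absurd (h t h') (lt_irrefl _)
  · intro e he h'; have := h e h'; omega

lemma pow_le_wt {A : Finset ℕ} {t : ℕ} (h : t ∈ A) : 2 ^ t ≤ wt A :=
  Finset.single_le_sum (f := fun x => 2 ^ x) (fun _ _ => Nat.zero_le _) h

lemma lt_of_wt_lt_pow {A : Finset ℕ} {t : ℕ} (h : wt A < 2 ^ t) : ∀ x ∈ A, x < t := by
  intro x hx
  by_contra hc
  have h1 := pow_le_wt hx
  have h2 : 2 ^ t ≤ 2 ^ x := Nat.pow_le_pow_right (by norm_num) (not_lt.mp hc)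
  omega

lemma wt_insert {A : Finset ℕ} {t : ℕ} (h : t ∉ A) : wt (insert t A) = 2 ^ t + wt A := by
  unfold wt; rw [Finset.sum_insert h]

/-- `K`-rainbow `k`-sets: vertex `x` has color `x % R`. -/
def Rb (R : ℕ) (K : Finset ℕ) (k : ℕ) (A : Finset ℕ) : Prop :=
  A.card = k ∧ (∀ x ∈ A, x % R ∈ K) ∧ ∀ x ∈ A, ∀ y ∈ A, x % R = y % R → x = y

def Init (R : ℕ) (K : Finset ℕ) (k : ℕ) (I : Finset (Finset ℕ)) : Prop :=
  (∀ A ∈ I, Rb R K k A) ∧ ∀ A ∈ I, ∀ B, Rb R K k B → wt B ≤ wt A → B ∈ I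

open Classical in
noncomputable def Bd (R : ℕ) (K : Finset ℕ) (k t : ℕ) : Finset (Finset ℕ) :=
  (range t).powerset.filter (Rb R K k)

lemma mem_Bd {R : ℕ} {K : Finset ℕ} {k t : ℕ} {A : Finset ℕ} :
    A ∈ Bd R K k t ↔ Rb R K k A ∧ ∀ x ∈ A, x < t := by
  simp only [Bd, mem_filter, mem_powerset, subset_iff, mem_range]; tauto

lemma Rb.erase {R : ℕ} {K : Finset ℕ} {k : ℕ} {A : Finset ℕ} {v : ℕ}
    (h : Rb R K (k+1) A) (hv : v ∈ A) : Rb R (K.erase (v % R)) k (A.erase v) := by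
  obtain ⟨h1, h2, h3⟩ := h
  refine ⟨by rw [card_erase_of_mem hv, h1]; rfl, ?_, ?_⟩
  · intro x hx
    rw [mem_erase] at hx ⊢
    exact ⟨fun e => hx.1 (h3 x hx.2 v hv e), h2 x hx.2⟩
  · intro x hx y hy e
    exact h3 x (mem_of_mem_erase hx) y (mem_of_mem_erase hy) e

lemma Rb.mono {R : ℕ} {K K' : Finset ℕ} {k : ℕ} {A : Finset ℕ} (hK : K ⊆ K')
    (h : Rb R K k A) : Rb R K' k A := ⟨h.1, fun x hx => hK (h.2.1 x hx), h.2.2⟩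

lemma Rb.notMem {R : ℕ} {K : Finset ℕ} {k : ℕ} {A : Finset ℕ} {v : ℕ}
    (h : Rb R (K.erase (v % R)) k A) : v ∉ A := fun hv => by simpa using h.2.1 v hv

lemma Rb.insert {R : ℕ} {K : Finset ℕ} {k : ℕ} {A : Finset ℕ} {v : ℕ}
    (h : Rb R (K.erase (v % R)) k A) (hv : v % R ∈ K) : Rb R K (k+1) (insert v A) := by
  have hn := h.notMem
  obtain ⟨h1, h2, h3⟩ := h
  refine ⟨by rw [card_insert_of_notMem hn, h1], ?_, ?_⟩
  · intro x hx
    rcases mem_insert.mp hx with rfl | hx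
    · exact hv
    · exact mem_of_mem_erase (h2 x hx)
  · intro x hx y hy e
    rcases mem_insert.mp hx with hx1 | hx1 <;> rcases mem_insert.mp hy with hy1 | hy1
    · rw [hx1, hy1]
    · have := h2 y hy1; rw [← e, hx1] at this; simp at this
    · have := h2 x hx1; rw [e, hy1] at this; simp at this
    · exact h3 x hx1 y hy1 e

lemma Rb.sub {R : ℕ} {K : Finset ℕ} {k : ℕ} {A B : Finset ℕ} (h : Rb R K k A) (hB : B ⊆ A) :
    Rb R K B.card B :=
  ⟨rfl, fun x hx => h.2.1 x (hB hx), fun x hx y hy e => h.2.2 x (hB hx) y (hB hy) e⟩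

lemma Rb.card_le {R : ℕ} {K : Finset ℕ} {k : ℕ} {A : Finset ℕ} (h : Rb R K k A) :
    k ≤ K.card := by
  rw [← h.1]
  exact card_le_card_of_injOn (fun x => x % R) (fun x hx => h.2.1 x hx)
    (fun x hx y hy e => h.2.2 x hx y hy e)

lemma init_Bd {R : ℕ} {K : Finset ℕ} {k t : ℕ} : Init R K k (Bd R K k t) := by
  refine ⟨fun A hA => (mem_Bd.mp hA).1, fun A hA B hB hw => ?_⟩
  rw [mem_Bd] at hA ⊢
  exact ⟨hB, lt_of_wt_lt_pow (lt_of_le_of_lt hw (wt_lt_pow hA.2))⟩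

lemma init_nested {R : ℕ} {K : Finset ℕ} {k : ℕ} {I J : Finset (Finset ℕ)}
    (hI : Init R K k I) (hJ : Init R K k J) : I ⊆ J ∨ J ⊆ I := by
  by_contra hc
  push Not at hc
  obtain ⟨h1, h2⟩ := hc
  obtain ⟨A, hA, hA'⟩ := not_subset.mp h1
  obtain ⟨B, hB, hB'⟩ := not_subset.mp h2
  rcases le_total (wt A) (wt B) with h | h
  · exact hA' (hJ.2 B hB A (hI.1 A hA) h)
  · exact hB' (hI.2 A hA B (hJ.1 B hB) h)

lemma init_sub_of_card {R : ℕ} {K : Finset ℕ} {k : ℕ} {I J : Finset (Finset ℕ)}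
    (hI : Init R K k I) (hJ : Init R K k J) (h : I.card ≤ J.card) : I ⊆ J := by
  rcases init_nested hI hJ with h1 | h1
  · exact h1
  · rw [eq_of_subset_of_card_le h1 h]

lemma init_union {R : ℕ} {K : Finset ℕ} {k : ℕ} {I J : Finset (Finset ℕ)}
    (hI : Init R K k I) (hJ : Init R K k J) : Init R K k (I ∪ J) := by
  rcases init_nested hI hJ with h | h
  · rwa [union_eq_right.mpr h]
  · rwa [union_eq_left.mpr h]

lemma init_union_card {R : ℕ} {K : Finset ℕ} {k M : ℕ} {I J : Finset (Finset ℕ)}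
    (hI : Init R K k I) (hJ : Init R K k J) (h1 : I.card ≤ M) (h2 : J.card ≤ M) :
    (I ∪ J).card ≤ M := by
  rcases init_nested hI hJ with h | h
  · rwa [union_eq_right.mpr h]
  · rwa [union_eq_left.mpr h]

lemma init_empty {R : ℕ} {K : Finset ℕ} {k : ℕ} : Init R K k ∅ := by
  constructor <;> simp

/-- total weight -/
def Wt (F : Finset (Finset ℕ)) : ℕ := ∑ A ∈ F, wt A

lemma exists_init_of_family {R : ℕ} {K : Finset ℕ} {k : ℕ} (F : Finset (Finset ℕ))
    (hF : ∀ A ∈ F, Rb R K k A) :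
    ∃ I, Init R K k I ∧ I.card = F.card ∧ (I = F ∨ Wt I < Wt F) := by
  induction hn : Wt F using Nat.strong_induction_on generalizing F with
  | _ n ih =>
  by_cases hI : Init R K k F
  · exact ⟨F, hI, rfl, Or.inl rfl⟩
  · have : ∃ A ∈ F, ∃ B, Rb R K k B ∧ wt B ≤ wt A ∧ B ∉ F := by
      by_contra hc
      push Not at hc
      exact hI ⟨hF, fun A hA B hB hw => hc A hA B hB hw⟩
    obtain ⟨A, hA, B, hB, hw, hBF⟩ := this
    have hne : wt B ≠ wt A := fun e => hBF (wt_inj e ▸ hA)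
    have hBe : B ∉ F.erase A := fun h => hBF (mem_of_mem_erase h)
    have hW : Wt (insert B (F.erase A)) < n := by
      unfold Wt at hn ⊢
      rw [sum_insert hBe, ← hn, ← sum_erase_add F wt hA]
      omega
    have hc : (insert B (F.erase A)).card = F.card := by
      rw [card_insert_of_notMem hBe, card_erase_add_one hA]
    obtain ⟨I, h1, h2, h3⟩ := ih _ hW (insert B (F.erase A)) (by
      intro C hC
      rcases mem_insert.mp hC with rfl | hC
      · exact hB
      · exact hF C (mem_of_mem_erase hC)) rfl
    refine ⟨I, h1, h2.trans hc, Or.inr ?_⟩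
    rcases h3 with rfl | h3 <;> omega

lemma exists_init_le {R : ℕ} {K : Finset ℕ} {k m : ℕ} (F : Finset (Finset ℕ))
    (hF : ∀ A ∈ F, Rb R K k A) (hm : m ≤ F.card) :
    ∃ I, Init R K k I ∧ I.card = m := by
  obtain ⟨F', h1, h2⟩ := exists_subset_card_eq hm
  obtain ⟨I, h3, h4, -⟩ := exists_init_of_family F' (fun A hA => hF A (h1 hA))
  exact ⟨I, h3, h4.trans h2⟩

lemma exists_init {R : ℕ} {K : Finset ℕ} {k : ℕ} (hK : K ⊆ range R) (m : ℕ)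
    (hk : k + 1 ≤ K.card) : ∃ I, Init R K (k+1) I ∧ I.card = m := by
  obtain ⟨T, hT, hTc⟩ := exists_subset_card_eq hk
  have hlt : ∀ x ∈ T, x < R := fun x hx => mem_range.mp (hK (hT hx))
  let f : ℕ → Finset ℕ := fun j => T.image (fun x => R * j + x)
  have hf : Function.Injective f := by
    intro i j hij
    have hne : T.Nonempty := by rw [← card_pos]; omega
    obtain ⟨x, hx⟩ := hne
    have : R * i + x ∈ f j := by rw [← hij]; exact mem_image_of_mem _ hx
    obtain ⟨y, hy, e⟩ := mem_image.mp this
    have h1 := hlt x hx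
    have h2 := hlt y hy
    have h3 : (R * j + y) / R = (R * i + x) / R := by rw [e]
    rw [Nat.mul_add_div (by omega), Nat.mul_add_div (by omega), Nat.div_eq_of_lt h1,
      Nat.div_eq_of_lt h2] at h3
    omega
  refine exists_init_le ((range m).image f) ?_ (by rw [card_image_of_injective _ hf, card_range])
  intro A hA
  obtain ⟨j, -, rfl⟩ := mem_image.mp hA
  refine ⟨?_, ?_, ?_⟩
  · rw [card_image_of_injective _ (fun a b h => by simpa using h), hTc]
  · intro x hx
    obtain ⟨y, hy, rfl⟩ := mem_image.mp hx
    rw [Nat.mul_add_mod, Nat.mod_eq_of_lt (hlt y hy)]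
    exact hT hy
  · intro x hx x' hx' e
    obtain ⟨y, hy, rfl⟩ := mem_image.mp hx
    obtain ⟨y', hy', rfl⟩ := mem_image.mp hx'
    rw [Nat.mul_add_mod, Nat.mul_add_mod, Nat.mod_eq_of_lt (hlt y hy),
      Nat.mod_eq_of_lt (hlt y' hy')] at e
    rw [e]

/-- The shadow of an initial segment is an initial segment. -/
lemma init_shadow {R : ℕ} {K : Finset ℕ} {k : ℕ} {I : Finset (Finset ℕ)} (hK : K ⊆ range R)
    (hI : Init R K (k+1) I) : Init R K k I.shadow := by
  have hsh : ∀ A ∈ I.shadow, Rb R K k A := by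
    intro A hA
    obtain ⟨S, hS, x, hx, rfl⟩ := mem_shadow_iff.mp hA
    exact ((hI.1 S hS).erase hx).mono (erase_subset _ _)
  refine ⟨hsh, ?_⟩
  intro A hA B hB hw
  rcases hw.eq_or_lt with he | hlt
  · rwa [wt_inj he]
  have hAR := hsh A hA
  obtain ⟨x, hxA, hxI⟩ := mem_shadow_iff_insert_mem.mp hA
  have hSR := hI.1 _ hxI
  -- the least addable vertex
  have hcard : (B.image (· % R)).card < K.card := by
    have h1 := hSR.card_le
    have h2 : (B.image (· % R)).card ≤ k := by rw [← hB.1]; exact card_image_le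
    omega
  have hex : ∃ y, y ∈ K ∧ y ∉ B.image (· % R) := by
    obtain ⟨y, hy, hy'⟩ := exists_mem_notMem_of_card_lt_card hcard
    exact ⟨y, hy, hy'⟩
  classical
  have hy := Nat.find_spec hex
  have hmin : ∀ z < Nat.find hex, z ∈ K → z ∈ B.image (· % R) := by
    intro z hz hzK
    have := Nat.find_min hex hz
    tauto
  set y := Nat.find hex with hydef
  have hyR : y < R := mem_range.mp (hK hy.1)
  have hymod : y % R = y := Nat.mod_eq_of_lt hyR
  have hRpos : 0 < R := by omega
  have hRb : Rb R K (k+1) (insert y B) := by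
    apply Rb.insert
    · refine ⟨hB.1, fun b hb => ?_, hB.2.2⟩
      rw [mem_erase]
      refine ⟨fun e => hy.2 (mem_image.mpr ⟨b, hb, by rw [e, hymod]⟩), hB.2.1 b hb⟩
    · rw [hymod]; exact hy.1
  have hyB : y ∉ B := fun h => hy.2 (mem_image.mpr ⟨y, h, hymod⟩)
  have key : wt (insert y B) ≤ wt (insert x A) := by
    obtain ⟨d, hdA, hdB, hd⟩ := wt_lt_exists hlt
    rcases lt_trichotomy y d with h | h | h
    · apply le_of_lt
      apply wt_lt_of (d := d) (mem_insert_of_mem hdA)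
      · simp only [mem_insert, not_or]; exact ⟨by omega, hdB⟩
      · intro e he hm
        rcases mem_insert.mp hm with rfl | hm
        · omega
        · exact mem_insert_of_mem ((hd e he).mp hm)
    · by_cases hxd : d < x
      · apply le_of_lt
        apply wt_lt_of (d := x) (mem_insert_self _ _)
        · simp only [mem_insert, not_or]
          exact ⟨by omega, fun hm => hxA ((hd x hxd).mp hm)⟩
        · intro e he hm
          rcases mem_insert.mp hm with rfl | hm
          · omega
          · exact mem_insert_of_mem ((hd e (by omega)).mp hm)
      · have hxd' : x < d := by
          rcases lt_or_eq_of_le (not_lt.mp hxd) with h' | h'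
          · exact h'
          · exact absurd (h' ▸ hdA) hxA
        have hsub : insert x A ⊆ insert y B := by
          intro z hz
          rcases lt_trichotomy z d with hzd | hzd | hzd
          · have hzK : z % R ∈ K := hSR.2.1 z hz
            have hzR : z % R = z := Nat.mod_eq_of_lt (by omega)
            rw [hzR] at hzK
            obtain ⟨b, hb, hbz⟩ := mem_image.mp (hmin z (by omega) hzK)
            have hbz : b % R = z := hbz
            rcases lt_trichotomy b d with hbd | hbd | hbd
            · have : b % R = b := Nat.mod_eq_of_lt (by omega)
              rw [this] at hbz
              subst hbz
              exact mem_insert_of_mem hb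
            · exact absurd (hbd ▸ hb) hdB
            · have hbA := (hd b hbd).mp hb
              have := hSR.2.2 z hz b (mem_insert_of_mem hbA) (by rw [hzR, hbz])
              omega
          · rw [hzd, ← h]; exact mem_insert_self _ _
          · rcases mem_insert.mp hz with rfl | hz
            · omega
            · exact mem_insert_of_mem ((hd z hzd).mpr hz)
        rw [eq_of_subset_of_card_le hsub (by rw [hRb.1, hSR.1])]
    · exfalso
      have hdK : d % R ∈ K := hAR.2.1 d hdA
      have hdR : d % R = d := Nat.mod_eq_of_lt (by omega)
      rw [hdR] at hdK
      obtain ⟨b, hb, hbd⟩ := mem_image.mp (hmin d h hdK)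
      have hbd : b % R = d := hbd
      rcases lt_trichotomy b d with h' | h' | h'
      · have : b % R = b := Nat.mod_eq_of_lt (by omega)
        omega
      · exact hdB (h' ▸ hb)
      · have hbA := (hd b h').mp hb
        have := hAR.2.2 d hdA b hbA (by rw [hdR, hbd])
        omega
  exact mem_shadow_iff_insert_mem.mpr ⟨y, hyB, hI.2 _ hxI _ hRb key⟩

/-- link and deletion -/
def lk (F : Finset (Finset ℕ)) (v : ℕ) : Finset (Finset ℕ) :=
  (F.filter (fun A => v ∈ A)).image (fun A => A.erase v)

def del (F : Finset (Finset ℕ)) (v : ℕ) : Finset (Finset ℕ) := F.filter (fun A => v ∉ A)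

lemma mem_lk {F : Finset (Finset ℕ)} {v : ℕ} {B : Finset ℕ} :
    B ∈ lk F v ↔ v ∉ B ∧ insert v B ∈ F := by
  simp only [lk, mem_image, mem_filter]
  constructor
  · rintro ⟨A, ⟨hA, hv⟩, rfl⟩
    exact ⟨notMem_erase _ _, by rwa [insert_erase hv]⟩
  · rintro ⟨h1, h2⟩
    exact ⟨insert v B, ⟨h2, mem_insert_self _ _⟩, erase_insert h1⟩

lemma mem_del {F : Finset (Finset ℕ)} {v : ℕ} {B : Finset ℕ} :
    B ∈ del F v ↔ B ∈ F ∧ v ∉ B := by simp [del]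

lemma insert_injOn {v : ℕ} {G : Finset (Finset ℕ)} (hG : ∀ B ∈ G, v ∉ B) :
    Set.InjOn (fun B : Finset ℕ => insert v B) (G : Set (Finset ℕ)) := by
  intro A hA B hB h
  have h : insert v A = insert v B := h
  rw [← erase_insert (hG A hA), h, erase_insert (hG B hB)]

lemma card_cone {v : ℕ} {G : Finset (Finset ℕ)} (hG : ∀ B ∈ G, v ∉ B) :
    (G.image (fun B => insert v B)).card = G.card := card_image_of_injOn (insert_injOn hG)

lemma del_union_cone (F : Finset (Finset ℕ)) (v : ℕ) :
    F = del F v ∪ (lk F v).image (fun B => insert v B) := by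
  ext A
  simp only [mem_union, mem_del, mem_image, mem_lk]
  constructor
  · intro h
    by_cases hv : v ∈ A
    · exact Or.inr ⟨A.erase v, ⟨notMem_erase _ _, by rwa [insert_erase hv]⟩, insert_erase hv⟩
    · exact Or.inl ⟨h, hv⟩
  · rintro (⟨h, -⟩ | ⟨B, ⟨-, h⟩, rfl⟩) <;> exact h

lemma disj_cone {v : ℕ} {F G : Finset (Finset ℕ)} (hF : ∀ B ∈ F, v ∉ B) :
    Disjoint F (G.image (fun B => insert v B)) := by
  rw [disjoint_left]
  intro A hA hA'
  obtain ⟨B, -, rfl⟩ := mem_image.mp hA'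
  exact hF _ hA (mem_insert_self _ _)

lemma card_del_lk (F : Finset (Finset ℕ)) (v : ℕ) : F.card = (del F v).card + (lk F v).card := by
  conv_lhs => rw [del_union_cone F v]
  rw [card_union_of_disjoint (disj_cone (fun B hB => (mem_del.mp hB).2)),
    card_cone (fun B hB => (mem_lk.mp hB).1)]

lemma notMem_shadow {F : Finset (Finset ℕ)} {v : ℕ} (h : ∀ B ∈ F, v ∉ B) :
    ∀ B ∈ F.shadow, v ∉ B := by
  intro B hB hv
  obtain ⟨A, hA, hs⟩ := exists_subset_of_mem_shadow hB
  exact h A hA (hs hv)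

lemma cone_shadow_sub {F : Finset (Finset ℕ)} {v : ℕ} :
    (lk F v).shadow.image (fun B => insert v B) ⊆ F.shadow := by
  intro A hA
  obtain ⟨B, hB, rfl⟩ := mem_image.mp hA
  obtain ⟨x, hx, hxF⟩ := mem_shadow_iff_insert_mem.mp hB
  obtain ⟨h1, h2⟩ := mem_lk.mp hxF
  simp only [mem_insert, not_or] at h1
  refine mem_shadow_iff_insert_mem.mpr ⟨x, ?_, ?_⟩
  · simp only [mem_insert, not_or]; exact ⟨fun e => h1.1 e.symm, hx⟩
  · rwa [Finset.insert_comm]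

lemma lk_sub_shadow {F : Finset (Finset ℕ)} {v : ℕ} : lk F v ⊆ F.shadow := by
  intro B hB
  exact mem_shadow_iff_insert_mem.mpr ⟨v, mem_lk.mp hB⟩

lemma shadow_del_lk (F : Finset (Finset ℕ)) (v : ℕ) :
    (del F v).shadow.card + (lk F v).shadow.card ≤ F.shadow.card := by
  have h1 : ∀ B ∈ (del F v).shadow, v ∉ B := notMem_shadow (fun B hB => (mem_del.mp hB).2)
  have h2 : ∀ B ∈ (lk F v).shadow, v ∉ B := notMem_shadow (fun B hB => (mem_lk.mp hB).1)
  rw [← card_cone h2, ← card_union_of_disjoint (disj_cone h1)]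
  apply card_le_card
  apply union_subset
  · exact shadow_mono (filter_subset _ _)
  · exact cone_shadow_sub

lemma shadow_union' (F G : Finset (Finset ℕ)) : (F ∪ G).shadow = F.shadow ∪ G.shadow := by
  ext A
  simp only [mem_shadow_iff_insert_mem, mem_union]
  constructor
  · rintro ⟨a, h1, h2 | h2⟩
    exacts [Or.inl ⟨a, h1, h2⟩, Or.inr ⟨a, h1, h2⟩]
  · rintro (⟨a, h1, h2⟩ | ⟨a, h1, h2⟩)
    exacts [⟨a, h1, Or.inl h2⟩, ⟨a, h1, Or.inr h2⟩]

lemma shadow_cone_sub {G : Finset (Finset ℕ)} {v : ℕ} (hG : ∀ B ∈ G, v ∉ B) :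
    (G.image (fun B => insert v B)).shadow ⊆ G ∪ G.shadow.image (fun B => insert v B) := by
  intro A hA
  obtain ⟨S, hS, x, hx, rfl⟩ := mem_shadow_iff.mp hA
  obtain ⟨B, hB, rfl⟩ := mem_image.mp hS
  rw [mem_union]
  by_cases hxv : x = v
  · subst hxv; left; rwa [erase_insert (hG B hB)]
  · right
    have hxB : x ∈ B := (mem_insert.mp hx).resolve_left hxv
    exact mem_image.mpr ⟨B.erase x, erase_mem_shadow hB hxB, by
      rw [erase_insert_of_ne (fun e => hxv e.symm)]⟩

end Frohm


namespace Frohm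
open Finset

/-- `r`-colorable `k`-uniform families. -/
def Col (r k : ℕ) (F : Finset (Finset ℕ)) : Prop :=
  (∀ A ∈ F, A.card = k) ∧ ∃ χ : ℕ → ℕ, ∀ A ∈ F, (∀ x ∈ A, χ x < r) ∧
    ∀ x ∈ A, ∀ y ∈ A, χ x = χ y → x = y

/-- minimal shadow size -/
noncomputable def mu (r k m : ℕ) : ℕ :=
  sInf {s | ∃ F, Col r k F ∧ F.card = m ∧ F.shadow.card = s}

lemma mu_le {r k : ℕ} {F : Finset (Finset ℕ)} (hF : Col r k F) : mu r k F.card ≤ F.shadow.card :=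
  Nat.sInf_le ⟨F, hF, rfl, rfl⟩

lemma mu_attained {r k m : ℕ} {F : Finset (Finset ℕ)} (hF : Col r k F) (hm : F.card = m) :
    ∃ F', Col r k F' ∧ F'.card = m ∧ F'.shadow.card = mu r k m :=
  Nat.sInf_mem (s := {s | ∃ F, Col r k F ∧ F.card = m ∧ F.shadow.card = s}) ⟨_, F, hF, hm, rfl⟩

lemma mu_zero (r k : ℕ) : mu r k 0 = 0 := by
  have : Col r k ∅ := ⟨by simp, fun _ => 0, by simp⟩
  have := mu_le this
  simpa using this

lemma col_of_rb {R : ℕ} {K : Finset ℕ} {k : ℕ} {F : Finset (Finset ℕ)}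
    (hF : ∀ A ∈ F, Rb R K k A) : Col K.card k F := by
  refine ⟨fun A hA => (hF A hA).1, ?_⟩
  let e := K.equivFin
  refine ⟨fun x => if h : x % R ∈ K then (e ⟨x % R, h⟩ : ℕ) else 0, ?_⟩
  intro A hA
  obtain ⟨-, h2, h3⟩ := hF A hA
  constructor
  · intro x hx
    simp only [h2 x hx, dif_pos]
    exact (e _).2
  · intro x hx y hy h
    simp only [h2 x hx, h2 y hy, dif_pos] at h
    have := e.injective (Fin.ext h)
    exact h3 x hx y hy (by simpa using this)

lemma shadow_image {f : ℕ → ℕ} (hf : Function.Injective f) (F : Finset (Finset ℕ)) :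
    (F.image (fun A => A.image f)).shadow = F.shadow.image (fun A => A.image f) := by
  ext B
  simp only [mem_shadow_iff, mem_image]
  constructor
  · rintro ⟨_, ⟨A, hA, rfl⟩, x, hx, rfl⟩
    obtain ⟨a, ha, rfl⟩ := mem_image.mp hx
    exact ⟨A.erase a, ⟨A, hA, a, ha, rfl⟩, by rw [image_erase hf]⟩
  · rintro ⟨_, ⟨A, hA, a, ha, rfl⟩, rfl⟩
    exact ⟨A.image f, ⟨A, hA, rfl⟩, f a, mem_image_of_mem _ ha, by rw [image_erase hf]⟩

lemma card_image_family {f : ℕ → ℕ} (hf : Function.Injective f) (F : Finset (Finset ℕ)) :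
    (F.image (fun A => A.image f)).card = F.card :=
  card_image_of_injective _ (Finset.image_injective hf)

lemma rb_of_col {R : ℕ} {K : Finset ℕ} {k : ℕ} {F : Finset (Finset ℕ)} (hR : 0 < R)
    (hK : K ⊆ range R) (hF : Col K.card k F) :
    ∃ F' : Finset (Finset ℕ), (∀ A ∈ F', Rb R K k A) ∧ F'.card = F.card ∧
      F'.shadow.card = F.shadow.card := by
  obtain ⟨h1, χ, hχ⟩ := hF
  let e := K.equivFin
  let g : ℕ → ℕ := fun j => if h : j < K.card then (e.symm ⟨j, h⟩ : ℕ) else 0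
  have hg : ∀ j, g j < R := by
    intro j
    by_cases h : j < K.card
    · simp only [g, dif_pos h]; exact mem_range.mp (hK (e.symm ⟨j, h⟩).2)
    · simp only [g, dif_neg h]; exact hR
  let f : ℕ → ℕ := fun x => R * x + g (χ x)
  have hfm : ∀ x, f x % R = g (χ x) := fun x => by
    simp only [f]; rw [Nat.mul_add_mod, Nat.mod_eq_of_lt (hg _)]
  have hfi : Function.Injective f := by
    intro x y h
    have h3 : f x / R = f y / R := by rw [h]
    simp only [f] at h3
    rw [Nat.mul_add_div hR, Nat.mul_add_div hR, Nat.div_eq_of_lt (hg _),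
      Nat.div_eq_of_lt (hg _)] at h3
    omega
  refine ⟨F.image (fun A => A.image f), ?_, card_image_family hfi F, ?_⟩
  · intro B hB
    obtain ⟨A, hA, rfl⟩ := mem_image.mp hB
    obtain ⟨h2, h3⟩ := hχ A hA
    refine ⟨by rw [card_image_of_injective _ hfi, h1 A hA], ?_, ?_⟩
    · intro x hx
      obtain ⟨y, hy, rfl⟩ := mem_image.mp hx
      rw [hfm]
      simp only [g, dif_pos (h2 y hy)]
      exact (e.symm _).2
    · intro x hx x' hx' h
      obtain ⟨y, hy, rfl⟩ := mem_image.mp hx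
      obtain ⟨y', hy', rfl⟩ := mem_image.mp hx'
      rw [hfm, hfm] at h
      simp only [g, dif_pos (h2 y hy), dif_pos (h2 y' hy')] at h
      have h4 := e.symm.injective (Subtype.ext h)
      rw [h3 y hy y' hy' (by simpa using h4)]
  · rw [shadow_image hfi, card_image_family hfi]

lemma exists_col (r k m : ℕ) (hk : k + 1 ≤ r) : ∃ F, Col r (k+1) F ∧ F.card = m := by
  obtain ⟨I, h1, h2⟩ := exists_init (R := r) (K := range r) (k := k) subset_rfl m (by simpa using hk)
  refine ⟨I, ?_, h2⟩
  have := col_of_rb h1.1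
  simpa using this

lemma mu_k0 (r m : ℕ) : mu r 0 m = 0 := by
  by_cases h : ∃ F, Col r 0 F ∧ F.card = m
  · obtain ⟨F, hF, hm⟩ := h
    have h1 := mu_le hF
    have : F.shadow = ∅ := by
      rw [eq_empty_iff_forall_notMem]
      intro A hA
      obtain ⟨S, hS, x, hx, -⟩ := mem_shadow_iff.mp hA
      have := card_eq_zero.mp (hF.1 S hS)
      rw [this] at hx; simp at hx
    rw [this, hm] at h1
    simpa using h1
  · unfold mu
    convert Nat.sInf_empty
    rw [Set.eq_empty_iff_forall_notMem]
    rintro s ⟨F, hF, hm, -⟩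
    exact h ⟨F, hF, hm⟩

lemma col_card_le {r k : ℕ} {F : Finset (Finset ℕ)} (hF : Col r k F) {A : Finset ℕ} (hA : A ∈ F) :
    k ≤ r := by
  obtain ⟨h1, χ, h⟩ := hF
  rw [← h1 A hA]
  have := card_le_card_of_injOn (s := A) (t := range r) χ
    (fun x hx => mem_coe.mpr (mem_range.mpr ((h A hA).1 x hx)))
    (fun x hx y hy e => (h A hA).2 x hx y hy e)
  simpa using this

lemma mu_big (r k m : ℕ) (hk : r < k) : mu r k m = 0 := by
  by_cases h : ∃ F, Col r k F ∧ F.card = m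
  · obtain ⟨F, hF, hm⟩ := h
    have : F = ∅ := by
      rw [eq_empty_iff_forall_notMem]
      intro A hA
      have := col_card_le hF hA
      omega
    subst this
    simp at hm
    subst hm
    exact mu_zero _ _
  · unfold mu
    convert Nat.sInf_empty
    rw [Set.eq_empty_iff_forall_notMem]
    rintro s ⟨F, hF, hm, -⟩
    exact h ⟨F, hF, hm⟩

lemma mu_subadd (r k x y : ℕ) : mu r k (x + y) ≤ mu r k x + mu r k y := by
  rcases k with _ | k
  · simp [mu_k0]
  rcases lt_or_ge r (k+1) with hk | hk
  · simp [mu_big _ _ _ hk]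
  obtain ⟨F, hF, hFm⟩ := exists_col r k x hk
  obtain ⟨F1, ⟨hA, χ1, hA'⟩, hA1, hA2⟩ := mu_attained hF hFm
  obtain ⟨F, hF, hFm⟩ := exists_col r k y hk
  obtain ⟨F2, ⟨hB, χ2, hB'⟩, hB1, hB2⟩ := mu_attained hF hFm
  let f : ℕ → ℕ := fun a => 2 * a
  let g : ℕ → ℕ := fun a => 2 * a + 1
  have hf : Function.Injective f := fun a b h => by simp only [f] at h; omega
  have hg : Function.Injective g := fun a b h => by simp only [g] at h; omega
  let E := F1.image (fun A => A.image f) ∪ F2.image (fun A => A.image g)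
  have hcE : E.card = x + y := by
    simp only [E]
    rw [card_union_of_disjoint, card_image_family hf, card_image_family hg, hA1, hB1]
    rw [disjoint_left]
    intro A h1 h2
    obtain ⟨S, hS, rfl⟩ := mem_image.mp h1
    obtain ⟨T, hT, hTS⟩ := mem_image.mp h2
    have hne : S.Nonempty := by rw [← card_pos, hA S hS]; omega
    obtain ⟨s, hs⟩ := hne
    have : f s ∈ T.image g := by rw [hTS]; exact mem_image_of_mem _ hs
    obtain ⟨t, -, ht⟩ := mem_image.mp this
    simp only [f, g] at ht; omega
  have hE : Col r (k+1) E := by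
    refine ⟨?_, fun z => if z % 2 = 0 then χ1 (z/2) else χ2 (z/2), ?_⟩
    · intro A hAE
      rcases mem_union.mp hAE with h | h
      · obtain ⟨S, hS, rfl⟩ := mem_image.mp h
        rw [card_image_of_injective _ hf, hA S hS]
      · obtain ⟨S, hS, rfl⟩ := mem_image.mp h
        rw [card_image_of_injective _ hg, hB S hS]
    · intro A hAE
      have e1 : ∀ a, f a % 2 = 0 := fun a => by simp only [f]; omega
      have e2 : ∀ a, g a % 2 = 1 := fun a => by simp only [g]; omega
      have e3 : ∀ a, f a / 2 = a := fun a => by simp only [f]; omega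
      have e4 : ∀ a, g a / 2 = a := fun a => by simp only [g]; omega
      rcases mem_union.mp hAE with h | h
      · obtain ⟨S, hS, rfl⟩ := mem_image.mp h
        constructor
        · intro z hz
          obtain ⟨a, ha, rfl⟩ := mem_image.mp hz
          simp only [e1, e3, if_true]
          exact (hA' S hS).1 a ha
        · intro z hz z' hz' he
          obtain ⟨a, ha, rfl⟩ := mem_image.mp hz
          obtain ⟨a', ha', rfl⟩ := mem_image.mp hz'
          simp only [e1, e3, if_true] at he
          rw [(hA' S hS).2 a ha a' ha' he]
      · obtain ⟨S, hS, rfl⟩ := mem_image.mp h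
        constructor
        · intro z hz
          obtain ⟨a, ha, rfl⟩ := mem_image.mp hz
          simp only [e2, e4, one_ne_zero, if_false]
          exact (hB' S hS).1 a ha
        · intro z hz z' hz' he
          obtain ⟨a, ha, rfl⟩ := mem_image.mp hz
          obtain ⟨a', ha', rfl⟩ := mem_image.mp hz'
          simp only [e2, e4, one_ne_zero, if_false] at he
          rw [(hB' S hS).2 a ha a' ha' he]
  have h1 := mu_le hE
  rw [hcE] at h1
  refine h1.trans ?_
  simp only [E]
  rw [shadow_union', shadow_image hf, shadow_image hg]
  refine (card_union_le _ _).trans ?_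
  rw [card_image_family hf, card_image_family hg, hA2, hB2]

/-- color swap -/
def csw (R c i x : ℕ) : ℕ :=
  if x % R = c then R * (x / R) + i else if x % R = i then R * (x / R) + c else x

lemma csw_mod {R c i : ℕ} (hc : c < R) (hi : i < R) (x : ℕ) :
    csw R c i x % R = if x % R = c then i else if x % R = i then c else x % R := by
  unfold csw
  split_ifs
  · rw [Nat.mul_add_mod, Nat.mod_eq_of_lt hi]
  · rw [Nat.mul_add_mod, Nat.mod_eq_of_lt hc]
  · rfl

lemma csw_div {R c i : ℕ} (hc : c < R) (hi : i < R) (x : ℕ) : csw R c i x / R = x / R := by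
  unfold csw
  split_ifs
  · rw [Nat.mul_add_div (by omega), Nat.div_eq_of_lt hi, add_zero]
  · rw [Nat.mul_add_div (by omega), Nat.div_eq_of_lt hc, add_zero]
  · rfl

lemma csw_inj {R c i : ℕ} (hc : c < R) (hi : i < R) : Function.Injective (csw R c i) := by
  intro x y h
  have h1 : csw R c i x / R = csw R c i y / R := by rw [h]
  have h2 : csw R c i x % R = csw R c i y % R := by rw [h]
  rw [csw_div hc hi, csw_div hc hi] at h1
  rw [csw_mod hc hi, csw_mod hc hi] at h2
  have h3 : x % R = y % R := by split_ifs at h2 <;> omega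
  rw [← Nat.div_add_mod x R, ← Nat.div_add_mod y R, h1, h3]

/-- D1 -/
lemma card_Bd_swap {R : ℕ} {K : Finset ℕ} {k t i : ℕ} (hK : K ⊆ range R) (ht : t % R ∈ K)
    (hi : i ∈ K) : (Bd R (K.erase i) k t).card ≤ (Bd R (K.erase (t % R)) k t).card := by
  by_cases hit : i = t % R
  · rw [hit]
  have hc : t % R < R := mem_range.mp (hK ht)
  have hi' : i < R := mem_range.mp (hK hi)
  have hinj := csw_inj hc hi'
  refine card_le_card_of_injOn (fun A => A.image (csw R (t % R) i)) ?_
    (Finset.image_injective hinj).injOn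
  intro A hA
  obtain ⟨⟨h1, h2, h3⟩, h4⟩ := mem_Bd.mp hA
  refine mem_coe.mpr (mem_Bd.mpr ⟨⟨by rw [card_image_of_injective _ hinj, h1], ?_, ?_⟩, ?_⟩)
  · intro z hz
    obtain ⟨x, hx, rfl⟩ := mem_image.mp hz
    have hx2 := mem_erase.mp (h2 x hx)
    rw [csw_mod hc hi', mem_erase]
    split_ifs with h5 h6
    · exact ⟨hit, hi⟩
    · exact absurd h6 hx2.1
    · exact ⟨h5, hx2.2⟩
  · intro z hz z' hz' he
    obtain ⟨x, hx, rfl⟩ := mem_image.mp hz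
    obtain ⟨y, hy, rfl⟩ := mem_image.mp hz'
    rw [csw_mod hc hi', csw_mod hc hi'] at he
    have hxy : x % R = y % R := by split_ifs at he <;> omega
    rw [h3 x hx y hy hxy]
  · intro z hz
    obtain ⟨x, hx, rfl⟩ := mem_image.mp hz
    have hx2 := mem_erase.mp (h2 x hx)
    have hxt := h4 x hx
    unfold csw
    split_ifs with h5 h6
    · have e1 := Nat.div_add_mod x R
      have e2 := Nat.div_add_mod t R
      have hlt : x / R < t / R := by
        by_contra hcon
        have : R * (t / R) ≤ R * (x / R) := Nat.mul_le_mul_left _ (not_lt.mp hcon)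
        omega
      have : R * (x / R + 1) ≤ R * (t / R) := Nat.mul_le_mul_left _ hlt
      rw [Nat.mul_add] at this
      omega
    · exact absurd h6 hx2.1
    · exact hxt

lemma Bd_mono {R : ℕ} {K : Finset ℕ} {k t t' : ℕ} (h : t ≤ t') : Bd R K k t ⊆ Bd R K k t' := by
  intro A hA
  rw [mem_Bd] at hA ⊢
  exact ⟨hA.1, fun x hx => (hA.2 x hx).trans_le h⟩

/-- D2 -/
lemma card_Bd_mono {R : ℕ} {K : Finset ℕ} {k t t' : ℕ} (hK : K ⊆ range R) (ht : t % R ∈ K)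
    (ht' : t' % R ∈ K) (h : t ≤ t') :
    (Bd R (K.erase (t % R)) k t).card ≤ (Bd R (K.erase (t' % R)) k t').card :=
  (card_le_card (Bd_mono h)).trans (card_Bd_swap hK ht' ht)

lemma Bd_zero {R : ℕ} {K : Finset ℕ} {k : ℕ} : Bd R K (k+1) 0 = ∅ := by
  rw [eq_empty_iff_forall_notMem]
  intro A hA
  obtain ⟨h1, h2⟩ := mem_Bd.mp hA
  have : A.Nonempty := by rw [← card_pos, h1.1]; omega
  obtain ⟨x, hx⟩ := this
  have := h2 x hx
  omega

lemma Bd_succ_of_notMem {R : ℕ} {K : Finset ℕ} {k t : ℕ} (ht : t % R ∉ K) :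
    Bd R K k (t+1) = Bd R K k t := by
  apply Subset.antisymm _ (Bd_mono (Nat.le_succ t))
  intro A hA
  obtain ⟨h1, h2⟩ := mem_Bd.mp hA
  refine mem_Bd.mpr ⟨h1, fun x hx => ?_⟩
  have := h2 x hx
  have hne : x ≠ t := fun e => ht (e ▸ h1.2.1 x hx)
  omega

/-- attach a vertex `t` to an initial segment below it -/
def att (R : ℕ) (K : Finset ℕ) (k t : ℕ) (I : Finset (Finset ℕ)) (B : Finset (Finset ℕ)) :
    Finset (Finset ℕ) := B ∪ I.image (fun A => insert t A)

lemma Bd_notMem {R : ℕ} {K : Finset ℕ} {k t : ℕ} : ∀ A ∈ Bd R K k t, t ∉ A :=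
  fun _ hA h => lt_irrefl _ ((mem_Bd.mp hA).2 t h)

section rec
variable {R : ℕ} {K : Finset ℕ} {k t : ℕ} {I : Finset (Finset ℕ)}

lemma card_att (hI : I ⊆ Bd R (K.erase (t % R)) k t) :
    (att R K k t I (Bd R K (k+1) t)).card = (Bd R K (k+1) t).card + I.card := by
  unfold att
  rw [card_union_of_disjoint (disj_cone Bd_notMem), card_cone (fun B hB => Bd_notMem _ (hI hB))]

lemma init_att (ht : t % R ∈ K) (hI : I ⊆ Bd R (K.erase (t % R)) k t)
    (hI' : Init R (K.erase (t % R)) k I) : Init R K (k+1) (att R K k t I (Bd R K (k+1) t)) := by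
  unfold att
  constructor
  · intro A hA
    rcases mem_union.mp hA with h | h
    · exact (mem_Bd.mp h).1
    · obtain ⟨B, hB, rfl⟩ := mem_image.mp h
      exact (hI'.1 B hB).insert ht
  · intro A hA C hC hw
    rcases mem_union.mp hA with h | h
    · exact mem_union_left _ (init_Bd.2 A h C hC hw)
    · obtain ⟨B, hB, rfl⟩ := mem_image.mp h
      have hB1 := mem_Bd.mp (hI hB)
      have htB : t ∉ B := Bd_notMem _ (hI hB)
      rw [wt_insert htB] at hw
      have hlt := wt_lt_pow hB1.2
      have hC2 : ∀ x ∈ C, x < t + 1 := by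
        apply lt_of_wt_lt_pow
        rw [pow_succ]; omega
      by_cases htC : t ∈ C
      · apply mem_union_right
        refine mem_image.mpr ⟨C.erase t, ?_, insert_erase htC⟩
        apply hI'.2 B hB _ (hC.erase htC)
        have := wt_insert (notMem_erase t C)
        rw [insert_erase htC] at this
        omega
      · apply mem_union_left
        refine mem_Bd.mpr ⟨hC, fun x hx => ?_⟩
        have := hC2 x hx
        have : x ≠ t := fun e => htC (e ▸ hx)
        omega

lemma att_full (ht : t % R ∈ K) :
    att R K k t (Bd R (K.erase (t % R)) k t) (Bd R K (k+1) t) = Bd R K (k+1) (t+1) := by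
  ext A
  unfold att
  rw [mem_union, mem_Bd, mem_Bd]
  constructor
  · rintro (⟨h1, h2⟩ | h)
    · exact ⟨h1, fun x hx => (h2 x hx).trans (Nat.lt_succ_self _)⟩
    · obtain ⟨B, hB, rfl⟩ := mem_image.mp h
      have hB1 := mem_Bd.mp hB
      refine ⟨hB1.1.insert ht, fun x hx => ?_⟩
      rcases mem_insert.mp hx with h5 | hx
      · omega
      · have := hB1.2 x hx; omega
  · rintro ⟨h1, h2⟩
    by_cases htA : t ∈ A
    · right
      refine mem_image.mpr ⟨A.erase t, mem_Bd.mpr ⟨h1.erase htA, fun x hx => ?_⟩, insert_erase htA⟩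
      have h3 := h2 x (mem_of_mem_erase hx)
      have := ne_of_mem_erase hx
      omega
    · left
      refine ⟨h1, fun x hx => ?_⟩
      have h3 := h2 x hx
      have : x ≠ t := fun e => htA (e ▸ hx)
      omega

lemma card_Bd_succ (ht : t % R ∈ K) : (Bd R K (k+1) (t+1)).card =
    (Bd R K (k+1) t).card + (Bd R (K.erase (t % R)) k t).card := by
  rw [← att_full ht, card_att subset_rfl]

lemma shadow_att_ge (hI : I ⊆ Bd R (K.erase (t % R)) k t) :
    (Bd R K (k+1) t).shadow.card + I.shadow.card ≤
      (att R K k t I (Bd R K (k+1) t)).shadow.card := by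
  have h := shadow_del_lk (att R K k t I (Bd R K (k+1) t)) t
  have h1 : del (att R K k t I (Bd R K (k+1) t)) t = Bd R K (k+1) t := by
    ext A
    rw [mem_del]
    unfold att
    rw [mem_union]
    constructor
    · rintro ⟨h1 | h1, h2⟩
      · exact h1
      · obtain ⟨B, hB, rfl⟩ := mem_image.mp h1
        exact absurd (mem_insert_self _ _) h2
    · intro h1
      exact ⟨Or.inl h1, Bd_notMem _ h1⟩
  have h2 : lk (att R K k t I (Bd R K (k+1) t)) t = I := by
    ext A
    rw [mem_lk]
    unfold att
    rw [mem_union]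
    constructor
    · rintro ⟨h0, h1 | h1⟩
      · exact absurd (mem_insert_self _ _) (Bd_notMem _ h1)
      · obtain ⟨B, hB, he⟩ := mem_image.mp h1
        rw [← erase_insert h0, ← he, erase_insert (Bd_notMem _ (hI hB))]
        exact hB
    · intro h1
      exact ⟨Bd_notMem _ (hI h1), Or.inr (mem_image_of_mem _ h1)⟩
  rwa [h1, h2] at h

/-- below `t`, links are in the shadow once there is at least one face -/
lemma Bd_link_sub (hR : 0 < R) (ht : t % R ∈ K) (hne : (Bd R K (k+1) t).Nonempty) :
    Bd R (K.erase (t % R)) k t ⊆ (Bd R K (k+1) t).shadow := by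
  intro A hA
  obtain ⟨h1, h2⟩ := mem_Bd.mp hA
  rw [mem_shadow_iff_insert_mem]
  rcases lt_or_ge t R with htR | htR
  · obtain ⟨S, hS⟩ := hne
    obtain ⟨hS1, hS2⟩ := mem_Bd.mp hS
    have : A.card < S.card := by rw [h1.1, hS1.1]; omega
    obtain ⟨s, hs, hsA⟩ := exists_mem_notMem_of_card_lt_card this
    refine ⟨s, hsA, mem_Bd.mpr ⟨?_, ?_⟩⟩
    · apply Rb.insert _ (hS1.2.1 s hs)
      refine ⟨h1.1, fun x hx => mem_erase.mpr ⟨fun e => ?_, mem_of_mem_erase (h1.2.1 x hx)⟩, h1.2.2⟩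
      rw [Nat.mod_eq_of_lt ((h2 x hx).trans htR), Nat.mod_eq_of_lt ((hS2 s hs).trans htR)] at e
      exact hsA (e ▸ hx)
    · intro x hx
      rcases mem_insert.mp hx with rfl | hx
      · exact hS2 _ hs
      · exact h2 x hx
  · have hmm : t % R % R = t % R := Nat.mod_mod _ _
    have h1' : Rb R (K.erase (t % R % R)) k A := by rwa [hmm]
    refine ⟨t % R, h1'.notMem, mem_Bd.mpr ⟨h1'.insert (by rwa [hmm]), ?_⟩⟩
    intro x hx
    rcases mem_insert.mp hx with rfl | hx
    · exact (Nat.mod_lt _ hR).trans_le htR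
    · exact h2 x hx

lemma Bd_link_small (hR : 0 < R) (ht : t % R ∈ K) (hne : Bd R K (k+1) t = ∅) :
    (Bd R (K.erase (t % R)) k t).card ≤ 1 := by
  rw [card_le_one]
  intro A hA B hB
  by_contra hAB
  rw [eq_empty_iff_forall_notMem] at hne
  obtain ⟨h1, h2⟩ := mem_Bd.mp hA
  rcases lt_or_ge t R with htR | htR
  · have : ∃ s ∈ B, s ∉ A := by
      by_contra hc
      push Not at hc
      have := eq_of_subset_of_card_le (s := B) (t := A) hc (by rw [h1.1, (mem_Bd.mp hB).1.1])
      exact hAB this.symm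
    obtain ⟨s, hs, hsA⟩ := this
    obtain ⟨hS1, hS2⟩ := mem_Bd.mp hB
    refine hne (insert s A) (mem_Bd.mpr ⟨?_, ?_⟩)
    · apply Rb.insert _ (mem_of_mem_erase (hS1.2.1 s hs))
      refine ⟨h1.1, fun x hx => mem_erase.mpr ⟨fun e => ?_, mem_of_mem_erase (h1.2.1 x hx)⟩, h1.2.2⟩
      rw [Nat.mod_eq_of_lt ((h2 x hx).trans htR), Nat.mod_eq_of_lt ((hS2 s hs).trans htR)] at e
      exact hsA (e ▸ hx)
    · intro x hx
      rcases mem_insert.mp hx with rfl | hx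
      · exact hS2 _ hs
      · exact h2 x hx
  · have hmm : t % R % R = t % R := Nat.mod_mod _ _
    have h1' : Rb R (K.erase (t % R % R)) k A := by rwa [hmm]
    refine hne (insert (t % R) A) (mem_Bd.mpr ⟨h1'.insert (by rwa [hmm]), ?_⟩)
    intro x hx
    rcases mem_insert.mp hx with rfl | hx
    · exact (Nat.mod_lt _ hR).trans_le htR
    · exact h2 x hx

lemma shadow_att_le (hR : 0 < R) (ht : t % R ∈ K) (hI : I ⊆ Bd R (K.erase (t % R)) k t)
    (hne : (Bd R K (k+1) t).Nonempty) :
    (att R K k t I (Bd R K (k+1) t)).shadow.card ≤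
      (Bd R K (k+1) t).shadow.card + I.shadow.card := by
  unfold att
  rw [shadow_union']
  have hn : ∀ B ∈ I, t ∉ B := fun B hB => Bd_notMem _ (hI hB)
  have h1 := shadow_cone_sub hn
  have h2 := hI.trans (Bd_link_sub hR ht hne)
  have h3 : (Bd R K (k+1) t).shadow ∪ (I.image (fun A => insert t A)).shadow ⊆
      (Bd R K (k+1) t).shadow ∪ I.shadow.image (fun A => insert t A) := by
    apply union_subset subset_union_left
    refine h1.trans (union_subset (h2.trans subset_union_left) subset_union_right)
  refine (card_le_card h3).trans ((card_union_le _ _).trans ?_)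
  have := card_image_le (s := I.shadow) (f := fun A => insert t A)
  omega

end rec

end Frohm

namespace Frohm
open Finset

def FFKm (R r k M : ℕ) : Prop := ∀ K ⊆ range R, K.card = r → ∀ I, Init R K k I → I.card ≤ M →
  I.shadow.card = mu r k I.card

def FFK (R r k : ℕ) : Prop := ∀ K ⊆ range R, K.card = r → ∀ I, Init R K k I →
  I.shadow.card = mu r k I.card

lemma FFK.m {R r k : ℕ} (h : FFK R r k) (M : ℕ) : FFKm R r k M :=
  fun K hK hc I hI _ => h K hK hc I hI

def Alem (R r k : ℕ) : Prop := ∀ K ⊆ range R, K.card = r → ∀ t x y, x ≤ (Bd R K k t).card →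
  y ≤ (Bd R K k t).card → (Bd R K k t).card ≤ x + y →
  mu r k (x + y - (Bd R K k t).card) + mu r k (Bd R K k t).card ≤ mu r k x + mu r k y

lemma erase_card_eq {K : Finset ℕ} {r c : ℕ} (hc : K.card = r + 1) (h : c ∈ K) :
    (K.erase c).card = r := by rw [card_erase_of_mem h]; omega

lemma erase_sub {K : Finset ℕ} {R c : ℕ} (hK : K ⊆ range R) : K.erase c ⊆ range R :=
  (erase_subset _ _).trans hK

variable {R r k M t m : ℕ} {K : Finset ℕ}

lemma exists_small (hm : m ≤ (Bd R K k t).card) :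
    ∃ I, Init R K k I ∧ I.card = m ∧ I ⊆ Bd R K k t := by
  obtain ⟨I, h1, h2⟩ := exists_init_le (R := R) (K := K) (k := k) (Bd R K k t)
    (fun A hA => (mem_Bd.1 hA).1) hm
  exact ⟨I, h1, h2, init_sub_of_card h1 init_Bd (by omega)⟩

lemma rec_lower (hK : K ⊆ range R) (hc : K.card = r + 1) (hF : FFKm R (r+1) (k+1) M)
    (hf : FFK R r k) (ht : t % R ∈ K) (hm : m ≤ (Bd R (K.erase (t % R)) k t).card)
    (hM : (Bd R K (k+1) t).card + m ≤ M) :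
    mu (r+1) (k+1) (Bd R K (k+1) t).card + mu r k m ≤
      mu (r+1) (k+1) ((Bd R K (k+1) t).card + m) := by
  obtain ⟨I, h1, h2, h3⟩ := exists_small hm
  have e1 := hF K hK hc _ (init_att ht h3 h1) (by rw [card_att h3, h2]; exact hM)
  have e2 := hF K hK hc _ (init_Bd (t := t)) (by omega)
  have e3 := hf _ (erase_sub hK) (erase_card_eq hc ht) I h1
  have := shadow_att_ge (K := K) h3
  rw [e1, e2, e3, card_att h3, h2] at this
  exact this

lemma rec_upper (hR : 0 < R) (hK : K ⊆ range R) (hc : K.card = r + 1) (hF : FFKm R (r+1) (k+1) M)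
    (hf : FFK R r k) (ht : t % R ∈ K) (hm : m ≤ (Bd R (K.erase (t % R)) k t).card)
    (hM : (Bd R K (k+1) t).card ≤ M) (h0 : 0 < (Bd R K (k+1) t).card) :
    mu (r+1) (k+1) ((Bd R K (k+1) t).card + m) ≤
      mu (r+1) (k+1) (Bd R K (k+1) t).card + mu r k m := by
  obtain ⟨I, h1, h2, h3⟩ := exists_small hm
  have e1 := mu_le (col_of_rb (fun A hA => (init_att ht h3 h1).1 A hA))
  have e2 := hF K hK hc _ (init_Bd (t := t)) (by omega)
  have e3 := hf _ (erase_sub hK) (erase_card_eq hc ht) I h1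
  have := shadow_att_le hR ht h3 (card_pos.1 h0)
  rw [hc, card_att h3, h2] at e1
  rw [e2, e3, h2] at this
  exact e1.trans this

lemma exists_level (T : ℕ) (hm : 0 < m) (hT : m ≤ (Bd R K (k+1) T).card) :
    ∃ t < T, t % R ∈ K ∧ (Bd R K (k+1) t).card < m ∧ m ≤ (Bd R K (k+1) (t+1)).card := by
  induction T with
  | zero => rw [Bd_zero] at hT; simp at hT; omega
  | succ T ih =>
    by_cases h : m ≤ (Bd R K (k+1) T).card
    · obtain ⟨t, h1, h2⟩ := ih h
      exact ⟨t, by omega, h2⟩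
    · refine ⟨T, by omega, ?_, by omega, hT⟩
      by_contra hn
      rw [Bd_succ_of_notMem hn] at hT
      exact h hT

lemma Rlem (hR : 0 < R) (hK : K ⊆ range R) (hc : K.card = r + 1) (hF : FFK R (r+1) (k+1))
    (hf : FFK R r k) (hA : Alem R r k) (ht : t % R ∈ K) (y : ℕ) : ∀ z,
    y ≤ (Bd R K (k+1) t).card → z ≤ (Bd R (K.erase (t % R)) k t).card → z ≤ y →
    mu (r+1) (k+1) (y - z) + mu r k (Bd R (K.erase (t % R)) k t).card ≤
      mu (r+1) (k+1) y + mu r k ((Bd R (K.erase (t % R)) k t).card - z) := by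
  induction y using Nat.strong_induction_on with
  | _ y ih =>
  intro z hy hz hzy
  set D := (Bd R (K.erase (t % R)) k t).card with hD
  rcases Nat.eq_zero_or_pos z with hz0 | hz0
  · subst hz0; simp
  rcases Nat.eq_zero_or_pos y with h0 | h0
  · omega
  obtain ⟨t', h1, h2, h3, h4⟩ := exists_level t h0 hy
  have hDD := card_Bd_mono (k := k) hK h2 ht h1.le
  rw [card_Bd_succ h2] at h4
  set N' := (Bd R K (k+1) t').card with hN'
  set D' := (Bd R (K.erase (t' % R)) k t').card with hD'
  obtain ⟨y', rfl⟩ : ∃ y', y = N' + y' := ⟨y - N', by omega⟩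
  have low := rec_lower (m := y') hK hc (hF.m (N' + y')) hf h2 (by omega) le_rfl
  rw [← hN'] at low
  by_cases hzy' : z ≤ y'
  · have up : mu (r+1) (k+1) (N' + (y' - z)) ≤ mu (r+1) (k+1) N' + mu r k (y' - z) := by
      rcases Nat.eq_zero_or_pos N' with hn | hn
      · have : D' ≤ 1 := Bd_link_small hR h2 (card_eq_zero.1 hn)
        rcases Nat.eq_zero_or_pos (y' - z) with hh | hh
        · rw [hh]; simp
        · omega
      · exact rec_upper hR hK hc (hF.m N') hf h2 (by omega) le_rfl hn
    have a := hA (K.erase (t % R)) (erase_sub hK) (erase_card_eq hc ht) t y' (D - z)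
      (by omega) (by omega) (by omega)
    rw [← hD, show y' + (D - z) - D = y' - z by omega] at a
    rw [show N' + y' - z = N' + (y' - z) by omega]
    omega
  · have b := ih N' (by omega) (z - y') (by omega) (by omega) (by omega)
    have s := mu_subadd r k y' (D - z)
    rw [show N' - (z - y') = N' + y' - z by omega] at b
    rw [show D - (z - y') = y' + (D - z) by omega] at b
    omega

lemma Alem_step (hR : 0 < R) (hF : FFK R (r+1) (k+1))
    (hf : FFK R r k) (hA : Alem R r k) : Alem R (r+1) (k+1) := by
  intro K hK hc t
  suffices H : ∀ x y, x ≤ (Bd R K (k+1) t).card →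
      y ≤ x → (Bd R K (k+1) t).card ≤ x + y →
      mu (r+1) (k+1) (x + y - (Bd R K (k+1) t).card) + mu (r+1) (k+1) (Bd R K (k+1) t).card ≤
      mu (r+1) (k+1) x + mu (r+1) (k+1) y by
    intro x y hx hy hxy
    rcases le_total y x with h | h
    · exact H x y hx h hxy
    · have := H y x hy h (by omega)
      rw [Nat.add_comm y x] at this
      omega
  induction t with
  | zero =>
    intro x y hx hy hxy
    rw [Bd_zero] at *
    simp at hx
    subst hx
    obtain rfl : y = 0 := by omega
    simp
  | succ t ih =>
    by_cases ht : t % R ∈ K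
    swap
    · rw [Bd_succ_of_notMem ht]; exact ih
    intro x y hx hy hxy
    have hRl := Rlem hR hK hc hF hf hA ht
    have up := fun m hm h0 => rec_upper (m := m) hR hK hc (hF.m _) hf ht hm le_rfl h0
    have low := fun m hm => rec_lower (m := m) hK hc (hF.m _) hf ht hm le_rfl
    have al := hA _ (erase_sub hK) (erase_card_eq hc ht) t
    have small : (Bd R K (k+1) t).card = 0 → (Bd R (K.erase (t % R)) k t).card ≤ 1 :=
      fun h => Bd_link_small hR ht (card_eq_zero.1 h)
    rw [card_Bd_succ ht] at *
    generalize (Bd R K (k+1) t).card = N at *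
    generalize (Bd R (K.erase (t % R)) k t).card = D at *
    by_cases hxN : x = N + D
    · subst hxN
      rw [show N + D + y - (N + D) = y by omega]; omega
    rcases Nat.eq_zero_or_pos N with h0 | h0
    · have := small h0
      omega
    have upD := up D le_rfl h0
    by_cases hxn : x < N
    · have i1 := ih x y (by omega) (by omega) (by omega)
      have i2 := hRl (x + y - N) D (by omega) le_rfl (by omega)
      rw [show D - D = 0 by omega, mu_zero] at i2
      rw [show x + y - (N + D) = x + y - N - D by omega]
      omega
    obtain ⟨x', rfl⟩ : ∃ x', x = N + x' := ⟨x - N, by omega⟩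
    have lx := low x' (by omega)
    by_cases hyn : y < N
    · have i2 := hRl y (D - x') (by omega) (by omega) (by omega)
      rw [show D - (D - x') = x' by omega] at i2
      rw [show N + x' + y - (N + D) = y - (D - x') by omega]
      omega
    obtain ⟨y', rfl⟩ : ∃ y', y = N + y' := ⟨y - N, by omega⟩
    have ly := low y' (by omega)
    by_cases hD : D ≤ x' + y'
    · have a := al x' y' (by omega) (by omega) hD
      have u := up (x' + y' - D) (by omega) h0
      rw [show N + x' + (N + y') - (N + D) = N + (x' + y' - D) by omega]
      omega
    · have i2 := hRl N (D - (x' + y')) (by omega) (by omega) (by omega)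
      rw [show D - (D - (x' + y')) = x' + y' by omega] at i2
      have s := mu_subadd r k x' y'
      rw [show N + x' + (N + y') - (N + D) = N - (D - (x' + y')) by omega]
      omega

end Frohm

namespace Frohm
open Finset

/-- a family split along a set `S` of vertices -/
def EF (B : Finset (Finset ℕ)) (S : Finset ℕ) (L : ℕ → Finset (Finset ℕ)) : Finset (Finset ℕ) :=
  B ∪ S.biUnion (fun v => (L v).image (fun A => insert v A))

def Clean (B : Finset (Finset ℕ)) (S : Finset ℕ) (L : ℕ → Finset (Finset ℕ)) : Prop :=
  (∀ A ∈ B, ∀ w ∈ S, w ∉ A) ∧ ∀ v ∈ S, ∀ A ∈ L v, ∀ w ∈ S, w ∉ A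

lemma mem_EF {B : Finset (Finset ℕ)} {S : Finset ℕ} {L : ℕ → Finset (Finset ℕ)} {A : Finset ℕ} :
    A ∈ EF B S L ↔ A ∈ B ∨ ∃ v ∈ S, ∃ C ∈ L v, insert v C = A := by
  simp [EF]

variable {B : Finset (Finset ℕ)} {S : Finset ℕ} {L : ℕ → Finset (Finset ℕ)}

lemma sum_EF (h : Clean B S L) (f : Finset ℕ → ℕ) :
    ∑ A ∈ EF B S L, f A = ∑ A ∈ B, f A + ∑ v ∈ S, ∑ A ∈ L v, f (insert v A) := by
  unfold EF
  rw [sum_union, sum_biUnion]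
  · congr 1
    refine sum_congr rfl fun v hv => ?_
    rw [sum_image (insert_injOn fun A hA => h.2 v hv A hA v hv)]
  · intro v hv w hw hvw
    rw [Function.onFun, disjoint_left]
    intro A hA hA'
    obtain ⟨C, hC, rfl⟩ := mem_image.1 hA
    obtain ⟨C', hC', e⟩ := mem_image.1 hA'
    have : w ∈ insert v C := by rw [← e]; simp
    rcases mem_insert.1 this with e | e
    · exact hvw e.symm
    · exact h.2 v hv C hC w hw e
  · rw [disjoint_left]
    intro A hA hA'
    obtain ⟨v, hv, hh⟩ := mem_biUnion.1 hA'
    obtain ⟨C, hC, rfl⟩ := mem_image.1 hh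
    exact h.1 _ hA v hv (mem_insert_self _ _)

lemma card_EF (h : Clean B S L) : (EF B S L).card = B.card + ∑ v ∈ S, (L v).card := by
  have := sum_EF h (fun _ => 1)
  simpa using this

lemma Wt_EF (h : Clean B S L) :
    Wt (EF B S L) = Wt B + ∑ v ∈ S, (2 ^ v * (L v).card + Wt (L v)) := by
  unfold Wt
  rw [sum_EF h]
  congr 1
  refine sum_congr rfl fun v hv => ?_
  rw [sum_congr rfl fun A hA => wt_insert (h.2 v hv A hA v hv), sum_add_distrib]
  simp [mul_comm]

lemma shadow_EF (h : Clean B S L) :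
    (EF B S L).shadow = EF (B.shadow ∪ S.biUnion L) S (fun v => (L v).shadow) := by
  ext A
  simp only [mem_shadow_iff, mem_EF, mem_union, mem_biUnion]
  constructor
  · rintro ⟨C, (hC | ⟨v, hv, C, hC, rfl⟩), a, ha, rfl⟩
    · exact Or.inl (Or.inl ⟨C, hC, a, ha, rfl⟩)
    · have hn := h.2 v hv C hC v hv
      by_cases e : a = v
      · subst e
        rw [erase_insert hn]
        exact Or.inl (Or.inr ⟨a, hv, hC⟩)
      · rw [mem_insert] at ha
        refine Or.inr ⟨v, hv, C.erase a, ⟨C, hC, a, ha.resolve_left e, rfl⟩, ?_⟩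
        rw [erase_insert_of_ne (Ne.symm e)]
  · rintro ((⟨C, hC, a, ha, rfl⟩ | ⟨v, hv, hC⟩) | ⟨v, hv, _, ⟨C, hC, a, ha, rfl⟩, rfl⟩)
    · exact ⟨C, Or.inl hC, a, ha, rfl⟩
    · have hn := h.2 v hv A hC v hv
      exact ⟨insert v A, Or.inr ⟨v, hv, A, hC, rfl⟩, v, by simp, erase_insert hn⟩
    · have hn := h.2 v hv C hC v hv
      have : v ≠ a := by rintro rfl; exact hn ha
      exact ⟨insert v C, Or.inr ⟨v, hv, C, hC, rfl⟩, a, by simp [ha], erase_insert_of_ne this⟩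

lemma clean_shadow (h : Clean B S L) :
    Clean (B.shadow ∪ S.biUnion L) S (fun v => (L v).shadow) := by
  constructor
  · intro A hA w hw
    rcases mem_union.1 hA with hA | hA
    · exact notMem_shadow (fun A hA => h.1 A hA w hw) A hA
    · obtain ⟨v, hv, hA⟩ := mem_biUnion.1 hA
      exact h.2 v hv A hA w hw
  · intro v hv A hA w hw
    exact notMem_shadow (fun A hA => h.2 v hv A hA w hw) A hA

lemma card_shadow_EF (h : Clean B S L) : (EF B S L).shadow.card =
    (B.shadow ∪ S.biUnion L).card + ∑ v ∈ S, (L v).shadow.card := by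
  rw [shadow_EF h, card_EF (clean_shadow h)]

lemma init_biUnion {R k M : ℕ} {K : Finset ℕ} {J : Finset (Finset ℕ)} (hJ : Init R K k J)
    (hM : J.card ≤ M) (S : Finset ℕ) (hS : ∀ v ∈ S, Init R K k (L v) ∧ (L v).card ≤ M) :
    (J ∪ S.biUnion L).card ≤ M := by
  suffices H : Init R K k (J ∪ S.biUnion L) ∧ (J ∪ S.biUnion L).card ≤ M from H.2
  induction S using Finset.induction_on with
  | empty => simpa using ⟨hJ, hM⟩
  | insert v S hv ih =>
    obtain ⟨h1, h2⟩ := ih fun v hv => hS v (mem_insert_of_mem hv)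
    have e : J ∪ (insert v S).biUnion L = (J ∪ S.biUnion L) ∪ L v := by
      rw [biUnion_insert, union_assoc, union_comm (L v)]
    obtain ⟨h3, h4⟩ := hS v (mem_insert_self _ _)
    rw [e]
    exact ⟨init_union h1 h3, init_union_card h1 h3 h2 h4⟩

lemma clean_of_rb {R k k' i : ℕ} {K : Finset ℕ} (hS : ∀ v ∈ S, v % R = i)
    (hB : ∀ A ∈ B, Rb R (K.erase i) k A) (hL : ∀ v ∈ S, ∀ A ∈ L v, Rb R (K.erase i) k' A) :
    Clean B S L := by
  constructor
  · intro A hA w hw hn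
    have := (hB A hA).2.1 w hn
    simp [hS w hw] at this
  · intro v hv A hA w hw hn
    have := (hL v hv A hA).2.1 w hn
    simp [hS w hw] at this

lemma rb_EF {R k i : ℕ} {K : Finset ℕ} (hi : i ∈ K) (hS : ∀ v ∈ S, v % R = i)
    (hB : ∀ A ∈ B, Rb R (K.erase i) (k+1) A) (hL : ∀ v ∈ S, ∀ A ∈ L v, Rb R (K.erase i) k A) :
    ∀ A ∈ EF B S L, Rb R K (k+1) A := by
  intro A hA
  rcases mem_EF.1 hA with hA | ⟨v, hv, C, hC, rfl⟩
  · exact (hB A hA).mono (erase_subset _ _)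
  · have := hL v hv C hC
    rw [← hS v hv] at this hi
    exact this.insert hi

lemma rb_lk {R k v : ℕ} {K : Finset ℕ} {F : Finset (Finset ℕ)} (hF : ∀ A ∈ F, Rb R K (k+1) A) :
    ∀ A ∈ lk F v, Rb R (K.erase (v % R)) k A := by
  intro A hA
  obtain ⟨h1, h2⟩ := mem_lk.1 hA
  have := (hF _ h2).erase (mem_insert_self v A)
  rwa [erase_insert h1] at this

lemma EF_eq {R i k : ℕ} {K : Finset ℕ} {F : Finset (Finset ℕ)} (hF : ∀ A ∈ F, Rb R K (k+1) A) :
    F = EF (F.filter (fun A => ∀ x ∈ A, x % R ≠ i)) ((F.biUnion id).filter (fun x => x % R = i))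
      (lk F) := by
  ext A
  rw [mem_EF]
  constructor
  · intro hA
    by_cases h : ∀ x ∈ A, x % R ≠ i
    · exact Or.inl (mem_filter.2 ⟨hA, h⟩)
    · push Not at h
      obtain ⟨x, hx, hxi⟩ := h
      refine Or.inr ⟨x, mem_filter.2 ⟨mem_biUnion.2 ⟨A, hA, hx⟩, hxi⟩, A.erase x, ?_, insert_erase hx⟩
      rw [mem_lk]
      exact ⟨notMem_erase _ _, by rwa [insert_erase hx]⟩
  · rintro (h | ⟨v, hv, C, hC, rfl⟩)
    · exact (mem_filter.1 h).1
    · exact (mem_lk.1 hC).2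

lemma lk_empty_of {F : Finset (Finset ℕ)} {v : ℕ} (h : v ∉ F.biUnion id) : lk F v = ∅ := by
  rw [eq_empty_iff_forall_notMem]
  intro A hA
  exact h (mem_biUnion.2 ⟨_, (mem_lk.1 hA).2, mem_insert_self _ _⟩)

lemma compress {R r k v : ℕ} {K : Finset ℕ} {F : Finset (Finset ℕ)} (hK : K ⊆ range R)
    (hc : K.card = r + 1) (hf : FFK R r k) (hf' : FFK R r (k+1))
    (hF : ∀ A ∈ F, Rb R K (k+1) A) (hv : v % R ∈ K)
    (hn : ¬ Init R (K.erase (v % R)) k (lk F v)) :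
    ∃ F', (∀ A ∈ F', Rb R K (k+1) A) ∧ F'.card = F.card ∧ F'.shadow.card ≤ F.shadow.card ∧
      Wt F' < Wt F := by
  set i := v % R with hi
  set F0 := F.filter (fun A => ∀ x ∈ A, x % R ≠ i) with hF0
  set S := (F.biUnion id).filter (fun x => x % R = i) with hSd
  have hS : ∀ v ∈ S, v % R = i := fun v hv => (mem_filter.1 hv).2
  have hvS : v ∈ S := by
    by_contra hh
    apply hn
    rw [lk_empty_of]
    · exact init_empty
    · intro h2; exact hh (mem_filter.2 ⟨h2, rfl⟩)
  have e : F = EF F0 S (lk F) := EF_eq hF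
  have r0 : ∀ A ∈ F0, Rb R (K.erase i) (k+1) A := by
    intro A hA
    obtain ⟨h1, h2⟩ := mem_filter.1 hA
    obtain ⟨a, b, c⟩ := hF A h1
    exact ⟨a, fun x hx => mem_erase.2 ⟨h2 x hx, b x hx⟩, c⟩
  have rL : ∀ v ∈ S, ∀ A ∈ lk F v, Rb R (K.erase i) k A := by
    intro v hv A hA
    have := rb_lk hF A hA
    rwa [hS v hv] at this
  have cl := clean_of_rb hS r0 rL
  obtain ⟨B', b1, b2, b3⟩ := exists_init_of_family F0 r0
  choose! L' l1 l2 l3 using fun v hv => exists_init_of_family (lk F v) (rL v hv)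
  have cl' : Clean B' S L' := clean_of_rb hS b1.1 (fun v hv => (l1 v hv).1)
  have c' : (K.erase i).card = r := erase_card_eq hc hv
  refine ⟨EF B' S L', rb_EF hv hS b1.1 (fun v hv => (l1 v hv).1), ?_, ?_, ?_⟩
  · rw [card_EF cl', b2, sum_congr rfl l2, ← card_EF cl, ← e]
  · rw [card_shadow_EF cl']
    conv_rhs => rw [e, card_shadow_EF cl]
    refine Nat.add_le_add ?_ (sum_le_sum fun v hv => ?_)
    · refine init_biUnion (init_shadow (erase_sub hK) b1) ?_ S fun v hv => ⟨l1 v hv, ?_⟩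
      · rw [hf' _ (erase_sub hK) c' _ b1, b2]
        have := mu_le (col_of_rb r0)
        rw [c'] at this
        exact this.trans (card_le_card subset_union_left)
      · rw [l2 v hv]
        exact card_le_card ((subset_biUnion_of_mem (lk F) hv).trans subset_union_right)
    · rw [hf _ (erase_sub hK) c' _ (l1 v hv), l2 v hv]
      have := mu_le (col_of_rb (rL v hv))
      rwa [c'] at this
  · rw [Wt_EF cl']
    conv_rhs => rw [e, Wt_EF cl]
    refine add_lt_add_of_le_of_lt ?_ (sum_lt_sum (fun v hv => ?_) ⟨v, hvS, ?_⟩)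
    · rcases b3 with h | h
      · rw [h]
      · exact h.le
    · rw [l2 v hv]
      rcases l3 v hv with h | h
      · rw [h]
      · omega
    · rw [l2 v hvS]
      rcases l3 v hvS with h | h
      · exact absurd (h ▸ l1 v hvS) hn
      · omega

end Frohm

namespace Frohm
open Finset

variable {R r k t m : ℕ} {K : Finset ℕ} {F : Finset (Finset ℕ)}

lemma rb_image {A : Finset ℕ} (h : Rb R K k A) (g : ℕ → ℕ) (hg : ∀ a ∈ A, g a % R = a % R) :
    Rb R K k (A.image g) := by
  obtain ⟨h1, h2, h3⟩ := h
  refine ⟨?_, ?_, ?_⟩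
  · rw [card_image_of_injOn, h1]
    intro a ha b hb hab
    refine h3 a ha b hb ?_
    have := congrArg (· % R) hab
    simpa [hg a ha, hg b hb] using this
  · intro x hx
    obtain ⟨a, ha, rfl⟩ := mem_image.1 hx
    rw [hg a ha]; exact h2 a ha
  · intro x hx y hy hxy
    obtain ⟨a, ha, rfl⟩ := mem_image.1 hx
    obtain ⟨b, hb, rfl⟩ := mem_image.1 hy
    simp only [hg a ha, hg b hb] at hxy
    rw [h3 a ha b hb hxy]

lemma rename {v v' : ℕ} (hF : ∀ A ∈ F, Rb R K k A) (hlt : v' < v) (hmod : v' % R = v % R)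
    (hv : v ∈ F.biUnion id) (hv' : v' ∉ F.biUnion id) :
    ∃ F', (∀ A ∈ F', Rb R K k A) ∧ F'.card = F.card ∧ F'.shadow.card ≤ F.shadow.card ∧
      Wt F' < Wt F := by
  set f : ℕ → ℕ := fun x => Equiv.swap v v' x with hf
  have finj : Function.Injective f := (Equiv.swap v v').injective
  have hle : ∀ A ∈ F, ∀ x ∈ A, f x ≤ x := by
    intro A hA x hx
    have h2 : x ≠ v' := by
      rintro rfl; exact hv' (mem_biUnion.2 ⟨A, hA, hx⟩)
    by_cases h1 : x = v
    · subst h1; simp [hf]; omega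
    · simp [hf, Equiv.swap_apply_of_ne_of_ne h1 h2]
  have hw : ∀ A, wt (A.image f) = ∑ x ∈ A, 2 ^ f x := fun A => by
    unfold wt; rw [sum_image finj.injOn]
  refine ⟨F.image (fun A => A.image f), ?_, card_image_family finj F, ?_, ?_⟩
  · intro A hA
    obtain ⟨C, hC, rfl⟩ := mem_image.1 hA
    refine rb_image (hF C hC) f fun a _ => ?_
    by_cases h1 : a = v
    · subst h1; simp [hf, hmod]
    · by_cases h2 : a = v'
      · subst h2; simp [hf, hmod]
      · simp [hf, Equiv.swap_apply_of_ne_of_ne h1 h2]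
  · rw [shadow_image finj, card_image_family finj]
  · unfold Wt
    rw [sum_image (fun A _ B _ h => image_injective finj h)]
    obtain ⟨A, hA, hvA⟩ := mem_biUnion.1 hv
    refine sum_lt_sum (fun B hB => ?_) ⟨A, hA, ?_⟩
    · rw [hw]
      exact sum_le_sum fun x hx => Nat.pow_le_pow_right (by norm_num) (hle B hB x hx)
    · rw [hw]
      refine sum_lt_sum (fun x hx => Nat.pow_le_pow_right (by norm_num) (hle A hA x hx))
        ⟨v, hvA, ?_⟩
      refine Nat.pow_lt_pow_right (by norm_num) ?_
      simp [hf, hlt]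

lemma lk_nonempty {v : ℕ} : (lk F v).Nonempty ↔ v ∈ F.biUnion id := by
  constructor
  · intro h
    by_contra hn
    rw [lk_empty_of hn] at h
    exact not_nonempty_empty h
  · intro h
    obtain ⟨A, hA, hv⟩ := mem_biUnion.1 h
    exact ⟨A.erase v, mem_lk.2 ⟨notMem_erase _ _, by rw [insert_erase (show v ∈ A from hv)]; exact hA⟩⟩

lemma exists_lower {A : Finset ℕ} {u x : ℕ} (hR : 0 < R) (hA : Rb R K k A) (hu : u % R ∈ K)
    (huA : u ∉ A) (hx : x ∈ A) (hux : u < x) :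
    ∃ A', Rb R K k A' ∧ wt A' < wt A ∧ u ∈ A' := by
  by_cases h : ∃ y ∈ A, y % R = u % R
  · obtain ⟨y, hy, hyu⟩ := h
    by_cases hlt : u < y
    · refine ⟨A.image (fun a => if a = y then u else a), rb_image hA _ ?_, ?_, ?_⟩
      · intro a ha
        by_cases e : a = y
        · simp [e, hyu]
        · simp [e]
      · refine wt_lt_of hy ?_ ?_
        · intro hm
          obtain ⟨a, ha, e⟩ := mem_image.1 hm
          split_ifs at e with h
          · omega
          · exact h e
        · intro e he hm
          obtain ⟨a, ha, e⟩ := mem_image.1 hm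
          split_ifs at e with h
          · omega
          · rwa [← e]
      · exact mem_image.2 ⟨y, hy, by simp⟩
    · have hne : y ≠ u := by rintro rfl; exact huA hy
      have hyx : y ≠ x := by omega
      have hRx : R ≤ x := by
        have h1 := Nat.div_add_mod y R
        have h2 := Nat.div_add_mod u R
        have : y / R < u / R := by
          by_contra hh
          have := Nat.mul_le_mul_left R (not_lt.1 hh)
          omega
        have := Nat.mul_le_mul_left R this
        rw [Nat.mul_succ] at this
        omega
      have hxm : x % R < x := lt_of_lt_of_le (Nat.mod_lt _ hR) hRx
      refine ⟨A.image (fun a => if a = y then u else if a = x then x % R else a),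
        rb_image hA _ ?_, ?_, ?_⟩
      · intro a ha
        by_cases e : a = y
        · simp [e, hyu]
        · by_cases e' : a = x
          · simp [e', Ne.symm hyx]
          · simp [e, e']
      · refine wt_lt_of hx ?_ ?_
        · intro hm
          obtain ⟨a, ha, e⟩ := mem_image.1 hm
          split_ifs at e with h h'
          · omega
          · omega
          · exact h' e
        · intro e he hm
          obtain ⟨a, ha, e⟩ := mem_image.1 hm
          split_ifs at e with h h'
          · omega
          · omega
          · rwa [← e]
      · exact mem_image.2 ⟨y, hy, by simp⟩
  · push Not at h
    obtain ⟨k, rfl⟩ : ∃ k', k = k' + 1 := by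
      have := card_pos.2 ⟨x, hx⟩
      rw [hA.1] at this
      exact ⟨k - 1, by omega⟩
    refine ⟨insert u (A.erase x), ?_, ?_, mem_insert_self _ _⟩
    · refine Rb.insert ⟨?_, ?_, ?_⟩ hu
      · rw [card_erase_of_mem hx, hA.1]; rfl
      · intro y hy
        exact mem_erase.2 ⟨h y (mem_of_mem_erase hy), hA.2.1 y (mem_of_mem_erase hy)⟩
      · exact fun y hy z hz => hA.2.2 y (mem_of_mem_erase hy) z (mem_of_mem_erase hz)
    · refine wt_lt_of hx ?_ ?_
      · simp; omega
      · intro e he hm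
        rcases mem_insert.1 hm with h | h
        · omega
        · exact mem_of_mem_erase h

lemma stable_contra (hR : 0 < R) (hK : K ⊆ range R) (hF : ∀ A ∈ F, Rb R K (k+1) A)
    (hst : ∀ v, v % R ∈ K → Init R (K.erase (v % R)) k (lk F v))
    (hgap : ∀ v v' : ℕ, v' < v → v' % R = v % R → v ∈ F.biUnion id → v' ∈ F.biUnion id)
    (hN : (Bd R K (k+1) t).card < F.card)
    (h1 : ∀ v ∈ F.biUnion id, F.card - (Bd R K (k+1) t).card < (lk F v).card)
    (h2 : ∀ v ∈ F.biUnion id, ∀ u < t, u % R ∈ K →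
      (Bd R (K.erase (u % R)) k u).card < (lk F v).card) : False := by
  have hcol : ∀ v ∈ F.biUnion id, v % R ∈ K := by
    intro v hv
    obtain ⟨A, hA, hvA⟩ := mem_biUnion.1 hv
    exact (hF A hA).2.1 v hvA
  obtain ⟨w, hw, hwt⟩ : ∃ w ∈ F.biUnion id, t ≤ w := by
    by_contra hh
    push Not at hh
    have : F ⊆ Bd R K (k+1) t := fun A hA =>
      mem_Bd.2 ⟨hF A hA, fun x hx => hh x (mem_biUnion.2 ⟨A, hA, hx⟩)⟩
    exact absurd (card_le_card this) (by omega)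
  have hused : ∀ u < t, u % R ∈ K → u ∈ F.biUnion id := by
    intro u hut huK
    by_contra hun
    have hne : u % R ≠ w % R := fun e => hun (hgap w u (by omega) e hw)
    have l1 := h2 w hw u hut huK
    have l2 := card_Bd_swap (k := k) hK huK (hcol w hw)
    have : ¬ lk F w ⊆ Bd R (K.erase (w % R)) k u := fun hs => by
      have := card_le_card hs
      omega
    obtain ⟨A, hA, hA'⟩ := not_subset.1 this
    have hrb := (hst w (hcol w hw)).1 A hA
    have huA : u ∉ A := fun hh => hun (mem_biUnion.2 ⟨_, (mem_lk.1 hA).2, mem_insert_of_mem hh⟩)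
    have : ∃ x ∈ A, u < x := by
      by_contra hh
      push Not at hh
      refine hA' (mem_Bd.2 ⟨hrb, fun x hx => lt_of_le_of_ne (hh x hx) ?_⟩)
      rintro rfl; exact huA hx
    obtain ⟨x, hx, hux⟩ := this
    obtain ⟨A', a1, a2, a3⟩ := exists_lower hR hrb (mem_erase.2 ⟨hne, huK⟩) huA hx hux
    have hA2 : A' ∈ lk F w := (hst w (hcol w hw)).2 A hA A' a1 a2.le
    exact hun (mem_biUnion.2 ⟨_, (mem_lk.1 hA2).2, mem_insert_of_mem a3⟩)
  have hsub : Bd R K (k+1) t ⊆ del F w := by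
    intro S hS
    obtain ⟨s1, s2⟩ := mem_Bd.1 hS
    have hne : S.Nonempty := card_pos.1 (by rw [s1.1]; omega)
    have hv := S.max'_mem hne
    set v := S.max' hne with hvd
    have hvK := s1.2.1 v hv
    have l := h2 v (hused v (s2 v hv) hvK) v (s2 v hv) hvK
    have hs := init_sub_of_card init_Bd (hst v hvK) l.le
    have : S.erase v ∈ Bd R (K.erase (v % R)) k v :=
      mem_Bd.2 ⟨s1.erase hv, fun x hx => lt_of_le_of_ne (S.le_max' x (mem_of_mem_erase hx))
        (ne_of_mem_erase hx)⟩
    have := (mem_lk.1 (hs this)).2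
    rw [insert_erase hv] at this
    exact mem_del.2 ⟨this, fun hh => absurd (s2 w hh) (by omega)⟩
  have e := card_del_lk F w
  have := card_le_card hsub
  have := h1 w hw
  omega

lemma exists_prev {u : ℕ} (hut : u < t) (hu : u % R ∈ K) :
    ∃ p < t, p % R ∈ K ∧ u ≤ p ∧ Bd R K k (p+1) = Bd R K k t := by
  induction t with
  | zero => omega
  | succ t ih =>
    by_cases ht : t % R ∈ K
    · exact ⟨t, by omega, ht, by omega, rfl⟩
    · have : u ≠ t := by rintro rfl; exact ht hu
      obtain ⟨p, h1, h2, h3, h4⟩ := ih (by omega)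
      exact ⟨p, by omega, h2, h3, by rw [h4, Bd_succ_of_notMem ht]⟩

lemma shadow_single (A : Finset ℕ) : (({A} : Finset (Finset ℕ)).shadow).card = A.card := by
  have : ({A} : Finset (Finset ℕ)).shadow = A.image A.erase := by
    simp [shadow]
  rw [this, card_image_of_injOn (erase_injOn A)]

lemma init_bounded {I : Finset (Finset ℕ)} (hI : Init R K k I) :
    ∃ T, I.card ≤ (Bd R K k T).card := by
  refine ⟨(I.biUnion id).sup id + 1, card_le_card fun A hA => mem_Bd.2 ⟨hI.1 A hA, fun x hx => ?_⟩⟩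
  exact Nat.lt_succ_of_le (le_sup (f := id) (mem_biUnion.2 ⟨A, hA, hx⟩))

lemma stable_case (hR : 0 < R) (hK : K ⊆ range R) (hc : K.card = r + 1) (hf : FFK R r k)
    (hA : Alem R r k) (hF : ∀ A ∈ F, Rb R K (k+1) A) {M : ℕ} (hM : F.card = M + 1)
    (hm : FFKm R (r+1) (k+1) M)
    (hst : ∀ v, v % R ∈ K → Init R (K.erase (v % R)) k (lk F v))
    (hgap : ∀ v v' : ℕ, v' < v → v' % R = v % R → v ∈ F.biUnion id → v' ∈ F.biUnion id)
    {I : Finset (Finset ℕ)} (hI : Init R K (k+1) I) (hIc : I.card = F.card) :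
    I.shadow.card ≤ F.shadow.card := by
  obtain ⟨T, hT⟩ := init_bounded hI
  obtain ⟨t, -, ht, t1, t2⟩ := exists_level T (by omega) hT
  rw [card_Bd_succ ht] at t2
  obtain ⟨m', hm'⟩ : ∃ m', I.card = (Bd R K (k+1) t).card + m' := ⟨_, (Nat.add_sub_of_le t1.le).symm⟩
  rcases Nat.eq_zero_or_pos (Bd R K (k+1) t).card with h0 | h0
  · have := Bd_link_small hR ht (card_eq_zero.1 h0)
    obtain ⟨A, rfl⟩ := card_eq_one.1 (show I.card = 1 by omega)
    obtain ⟨C, rfl⟩ := card_eq_one.1 (show F.card = 1 by omega)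
    rw [shadow_single, shadow_single, (hI.1 A (by simp)).1, (hF C (by simp)).1]
  have up : I.shadow.card ≤ mu (r+1) (k+1) (Bd R K (k+1) t).card + mu r k m' := by
    obtain ⟨I', i1, i2, i3⟩ := exists_small (show m' ≤ (Bd R (K.erase (t % R)) k t).card by omega)
    have e : I = att R K k t I' (Bd R K (k+1) t) := by
      have hcd := card_att (K := K) i3
      exact eq_of_subset_of_card_le (init_sub_of_card hI (init_att ht i3 i1) (by omega)) (by omega)
    have := shadow_att_le hR ht i3 (card_pos.1 h0)
    rw [← e, hm K hK hc _ init_Bd (by omega), hf _ (erase_sub hK) (erase_card_eq hc ht) _ i1, i2]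
      at this
    exact this
  have hcol : ∀ v ∈ F.biUnion id, v % R ∈ K := by
    intro v hv
    obtain ⟨A, hA, hvA⟩ := mem_biUnion.1 hv
    exact (hF A hA).2.1 v hvA
  have lowF : ∀ v ∈ F.biUnion id, 0 < (lk F v).card ∧ (lk F v).card ≤ F.card ∧
      mu (r+1) (k+1) (F.card - (lk F v).card) + mu r k (lk F v).card ≤ F.shadow.card := by
    intro v hv
    have e := card_del_lk F v
    refine ⟨card_pos.2 (lk_nonempty.2 hv), by omega, le_trans ?_ (shadow_del_lk F v)⟩
    have h1 := mu_le (col_of_rb (fun A hA => hF A (mem_del.1 hA).1) : Col K.card (k+1) (del F v))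
    have h2 := mu_le (col_of_rb (rb_lk (v := v) hF))
    rw [erase_card_eq hc (hcol v hv)] at h2
    rw [hc] at h1
    rw [show F.card - (lk F v).card = (del F v).card by omega]
    omega
  refine up.trans ?_
  by_cases c1 : ∃ v ∈ F.biUnion id, (lk F v).card ≤ m'
  · obtain ⟨v, hv, hvm⟩ := c1
    obtain ⟨p1, p2, p3⟩ := lowF v hv
    have low := rec_lower (m := m' - (lk F v).card) hK hc hm hf ht (by omega) (by omega)
    have s := mu_subadd r k (m' - (lk F v).card) (lk F v).card
    rw [show m' - (lk F v).card + (lk F v).card = m' by omega] at s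
    rw [show F.card - (lk F v).card = (Bd R K (k+1) t).card + (m' - (lk F v).card) by omega] at p3
    omega
  by_cases c2 : ∃ v ∈ F.biUnion id, ∃ u < t, u % R ∈ K ∧
      (lk F v).card ≤ (Bd R (K.erase (u % R)) k u).card
  · obtain ⟨v, hv, u, hu, huK, hD⟩ := c2
    push Not at c1
    have hvm := c1 v hv
    obtain ⟨p1, p2, p3⟩ := lowF v hv
    obtain ⟨p, q1, q2, q3, q4⟩ := exists_prev (k := k+1) hu huK
    have hmono := card_Bd_mono (k := k) hK huK q2 q3
    have hNp := card_Bd_succ (k := k) q2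
    rw [q4] at hNp
    rcases Nat.eq_zero_or_pos (Bd R K (k+1) p).card with z | z
    · have := Bd_link_small hR q2 (card_eq_zero.1 z)
      omega
    have u1 := rec_upper hR hK hc hm hf q2 le_rfl (by omega) z
    have a := hA _ (erase_sub hK) (erase_card_eq hc q2) p (lk F v).card
      ((Bd R (K.erase (p % R)) k p).card + m' - (lk F v).card) (by omega) (by omega) (by omega)
    have low := rec_lower (m := (Bd R (K.erase (p % R)) k p).card + m' - (lk F v).card) hK hc hm hf
      q2 (by omega) (by omega)
    generalize (Bd R (K.erase (p % R)) k p).card = D at *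
    generalize (lk F v).card = b at *
    rw [show b + (D + m' - b) - D = m' by omega] at a
    rw [show F.card - b = (Bd R K (k+1) p).card + (D + m' - b) by omega] at p3
    rw [← hNp] at u1
    omega
  exfalso
  push Not at c1 c2
  refine stable_contra hR hK hF hst hgap (by omega) (fun v hv => ?_) c2
  have := c1 v hv
  omega

lemma ffkm_of {M : ℕ} (hR : 0 < R) (H : ∀ K ⊆ range R, K.card = r → ∀ F : Finset (Finset ℕ), (∀ A ∈ F, Rb R K k A) →
    F.card ≤ M → ∀ I, Init R K k I → I.card = F.card → I.shadow.card ≤ F.shadow.card) :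
    FFKm R r k M := by
  intro K hK hc I hI hM
  have col : Col r k I := hc ▸ col_of_rb hI.1
  refine le_antisymm ?_ (mu_le col)
  obtain ⟨F, f1, f2, f3⟩ := mu_attained col rfl
  subst hc
  obtain ⟨F', g1, g2, g3⟩ := rb_of_col hR hK f1
  rw [← f3, ← g3]
  exact H K hK rfl F' g1 (by omega) I hI (by omega)

lemma FFK_step (hR : 0 < R) (hf : FFK R r k) (hf' : FFK R r (k+1)) (hA : Alem R r k) :
    FFK R (r+1) (k+1) := by
  suffices H : ∀ M, FFKm R (r+1) (k+1) M from
    fun K hK hc I hI => H _ K hK hc I hI le_rfl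
  intro M
  induction M with
  | zero =>
    intro K hK hc I hI h0
    rw [card_eq_zero.1 (Nat.le_zero.1 h0)]
    simp [mu_zero]
  | succ M ih =>
    refine ffkm_of hR ?_
    intro K hK hc F
    induction hW : Wt F using Nat.strong_induction_on generalizing F with
    | _ W ihW =>
    subst hW
    intro hF hM I hI hIc
    by_cases hlt : F.card ≤ M
    · have h1 := ih K hK hc I hI (by omega)
      have h2 := mu_le (col_of_rb hF)
      rw [hc, ← hIc] at h2
      omega
    by_cases hst : ∀ v, v % R ∈ K → Init R (K.erase (v % R)) k (lk F v)
    swap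
    · push Not at hst
      obtain ⟨v, hv, hn⟩ := hst
      obtain ⟨F', a1, a2, a3, a4⟩ := compress hK hc hf hf' hF hv hn
      exact (ihW _ a4 F' rfl a1 (by omega) I hI (by omega)).trans a3
    by_cases hgap : ∀ v v' : ℕ, v' < v → v' % R = v % R → v ∈ F.biUnion id → v' ∈ F.biUnion id
    swap
    · push Not at hgap
      obtain ⟨v, v', g1, g2, g3, g4⟩ := hgap
      obtain ⟨F', a1, a2, a3, a4⟩ := rename hF g1 g2 g3 g4
      exact (ihW _ a4 F' rfl a1 (by omega) I hI (by omega)).trans a3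
    exact stable_case hR hK hc hf hA hF (M := M) (by omega) ih hst hgap hI hIc

lemma main_ffk (hR : 0 < R) (r : ℕ) : ∀ k, FFK R r k ∧ Alem R r k := by
  induction r with
  | zero =>
    intro k
    cases k with
    | zero =>
      refine ⟨fun K hK hc I hI => ?_, fun K hK hc t x y _ _ _ => by simp [mu_k0]⟩
      rw [mu_k0, card_eq_zero, eq_empty_iff_forall_notMem]
      intro A hA
      obtain ⟨C, hC, a, ha, rfl⟩ := mem_shadow_iff.1 hA
      have := (hI.1 C hC).1
      rw [card_eq_zero] at this
      simp [this] at ha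
    | succ k =>
      refine ⟨fun K hK hc I hI => ?_, fun K hK hc t x y _ _ _ => by simp [mu_big]⟩
      have : I = ∅ := by
        rw [eq_empty_iff_forall_notMem]
        intro A hA
        have := (hI.1 A hA).card_le
        omega
      rw [this]; simp [mu_zero]
  | succ r ih =>
    intro k
    cases k with
    | zero =>
      refine ⟨fun K hK hc I hI => ?_, fun K hK hc t x y _ _ _ => by simp [mu_k0]⟩
      rw [mu_k0, card_eq_zero, eq_empty_iff_forall_notMem]
      intro A hA
      obtain ⟨C, hC, a, ha, rfl⟩ := mem_shadow_iff.1 hA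
      have := (hI.1 C hC).1
      rw [card_eq_zero] at this
      simp [this] at ha
    | succ k =>
      have h := FFK_step hR (ih k).1 (ih (k+1)).1 (ih k).2
      exact ⟨h, Alem_step hR h (ih k).1 (ih k).2⟩

end Frohm

namespace Frohm
open Finset

lemma exists_init_size {R k m : ℕ} {K : Finset ℕ} (hK : K ⊆ range R)
    (h : m = 0 ∨ k + 1 ≤ K.card) : ∃ I, Init R K (k+1) I ∧ I.card = m := by
  rcases h with rfl | h
  · exact ⟨∅, init_empty, rfl⟩
  · exact exists_init hK m h

lemma num_bound (r k a b s : ℕ) (l : ℕ → ℕ) (hb : mu r (k+2) b ≤ a) (fb : b = 0 ∨ k + 2 ≤ r)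
    (hl : ∀ j < s, l j ≤ a) (fl : ∀ j < s, l j = 0 ∨ k + 1 ≤ r) :
    mu (r+1) (k+2) (b + ∑ j ∈ range s, l j) ≤ a + ∑ j ∈ range s, mu r (k+1) (l j) := by
  have hR : 0 < r + 1 := Nat.succ_pos r
  set R := r + 1 with hRd
  set K := range R with hKd
  have hK : K ⊆ range R := subset_rfl
  have hc : K.card = r + 1 := card_range _
  have hi : r ∈ K := by simp [hKd, hRd]
  have c' := erase_card_eq hc hi
  have hK' := erase_sub (c := r) hK
  obtain ⟨B, b1, b2⟩ := exists_init_size (R := R) (m := b) (k := k+1) hK' (by rw [c']; exact fb)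
  have : ∀ j, ∃ I, j < s → Init R (K.erase r) (k+1) I ∧ I.card = l j := by
    intro j
    by_cases hj : j < s
    · obtain ⟨I, h⟩ := exists_init_size (R := R) (m := l j) (k := k) hK' (by rw [c']; exact fl j hj)
      exact ⟨I, fun _ => h⟩
    · exact ⟨∅, fun h => absurd h hj⟩
  choose L hL using this
  set S := (range s).image (fun j => R * j + r) with hS
  have hdiv : ∀ j, (R * j + r) / R = j := fun j => by
    rw [Nat.mul_add_div hR, Nat.div_eq_of_lt (by omega)]; simp
  have hSm : ∀ v ∈ S, v % R = r ∧ v / R < s := by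
    intro v hv
    obtain ⟨j, hj, rfl⟩ := mem_image.1 hv
    rw [hdiv, Nat.mul_add_mod, Nat.mod_eq_of_lt (by omega)]
    exact ⟨rfl, mem_range.1 hj⟩
  have hsum : ∀ f : ℕ → ℕ, ∑ v ∈ S, f (v / R) = ∑ j ∈ range s, f j := by
    intro f
    rw [hS, sum_image]
    · simp [hdiv]
    · intro x _ y _ hxy
      have := congrArg (· / R) hxy
      simpa [hdiv] using this
  have hLS : ∀ v ∈ S, Init R (K.erase r) (k+1) (L (v / R)) ∧ (L (v / R)).card = l (v / R) :=
    fun v hv => hL _ (hSm v hv).2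
  have cl : Clean B S (fun v => L (v / R)) :=
    clean_of_rb (fun v hv => (hSm v hv).1) b1.1 (fun v hv => (hLS v hv).1.1)
  have rb := rb_EF hi (fun v hv => (hSm v hv).1) b1.1 (fun v hv => (hLS v hv).1.1)
  have h1 := mu_le (col_of_rb rb)
  rw [hc, card_EF cl, card_shadow_EF cl, b2, sum_congr rfl (fun v hv => (hLS v hv).2),
    hsum l] at h1
  refine h1.trans (Nat.add_le_add ?_ ?_)
  · refine init_biUnion (init_shadow hK' b1) ?_ S fun v hv => ⟨(hLS v hv).1, ?_⟩
    · rw [(main_ffk hR r (k+2)).1 _ hK' c' _ b1, b2]; exact hb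
    · rw [(hLS v hv).2]; exact hl _ (hSm v hv).2
  · rw [← hsum (fun j => mu r (k+1) (l j))]
    refine le_of_eq (sum_congr rfl fun v hv => ?_)
    rw [(main_ffk hR r (k+1)).1 _ hK' c' _ (hLS v hv).1, (hLS v hv).2]

lemma mu_one_le (r m : ℕ) : mu (r+1) 1 m ≤ 1 := by
  obtain ⟨F, h1, rfl⟩ := exists_col (r+1) 0 m (by omega)
  refine (mu_le h1).trans ?_
  have : F.shadow ⊆ {∅} := by
    intro A hA
    obtain ⟨C, hC, a, ha, rfl⟩ := mem_shadow_iff.1 hA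
    have := h1.1 C hC
    rw [mem_singleton, ← card_eq_zero, card_erase_of_mem ha, this]
  simpa using card_le_card this

section graph
variable {V : Type*} [Fintype V] [DecidableEq V] (G : SimpleGraph V) [DecidableRel G.Adj]

def cl (U : Finset V) (k : ℕ) : ℕ := ((G.cliqueFinset k).filter (fun A => A ⊆ U)).card

variable {G}

lemma cl_mono {U W : Finset V} (h : U ⊆ W) (k : ℕ) : cl G U k ≤ cl G W k :=
  card_le_card fun A hA => by
    rw [mem_filter] at hA ⊢
    exact ⟨hA.1, hA.2.trans h⟩

lemma cl_zero (U : Finset V) : cl G U 0 = 1 := by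
  unfold cl
  rw [card_eq_one]
  refine ⟨∅, ?_⟩
  ext A
  simp only [mem_filter, SimpleGraph.mem_cliqueFinset_iff, SimpleGraph.isNClique_zero,
    mem_singleton]
  constructor
  · exact fun h => h.1
  · rintro rfl; simp

lemma cl_eq_zero {U : Finset V} {k : ℕ} : cl G U k = 0 ↔ ∀ A ⊆ U, ¬ G.IsNClique k A := by
  unfold cl
  rw [card_eq_zero, filter_eq_empty_iff]
  simp only [SimpleGraph.mem_cliqueFinset_iff]
  exact ⟨fun h A hA hc => h hc hA, fun h A hc hA => h A hA hc⟩

lemma cl_zero_succ {U : Finset V} {k : ℕ} (h : cl G U k = 0) : cl G U (k+1) = 0 := by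
  rw [cl_eq_zero] at *
  intro A hA hc
  have hne : A.Nonempty := card_pos.1 (by rw [hc.card_eq]; omega)
  obtain ⟨a, ha⟩ := hne
  exact h (A.erase a) ((erase_subset _ _).trans hA) (by simpa using hc.erase_of_mem ha)

lemma cl_zero_le {U : Finset V} {k j : ℕ} (h : cl G U k = 0) (hkj : k ≤ j) : cl G U j = 0 := by
  induction j, hkj using Nat.le_induction with
  | base => exact h
  | succ j _ ih => exact cl_zero_succ ih

lemma cl_insert {W : Finset V} {q : V} (hq : q ∉ W) (k : ℕ) :
    cl G (insert q W) (k+1) = cl G W (k+1) + cl G (W.filter (G.Adj q)) k := by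
  unfold cl
  have e : ((G.cliqueFinset (k+1)).filter (fun A => A ⊆ insert q W)) =
      ((G.cliqueFinset (k+1)).filter (fun A => A ⊆ W)) ∪
      ((G.cliqueFinset k).filter (fun A => A ⊆ W.filter (G.Adj q))).image (fun A => insert q A) := by
    ext A
    simp only [mem_filter, mem_union, mem_image, SimpleGraph.mem_cliqueFinset_iff]
    constructor
    · rintro ⟨h1, h2⟩
      by_cases hA : q ∈ A
      · refine Or.inr ⟨A.erase q, ⟨by simpa using h1.erase_of_mem hA, ?_⟩, insert_erase hA⟩
        intro x hx
        obtain ⟨x1, x2⟩ := mem_erase.1 hx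
        refine mem_filter.2 ⟨(mem_insert.1 (h2 x2)).resolve_left x1, ?_⟩
        exact h1.isClique hA x2 (Ne.symm x1)
      · exact Or.inl ⟨h1, fun x hx => (mem_insert.1 (h2 hx)).resolve_left
          (by rintro rfl; exact hA hx)⟩
    · rintro (⟨h1, h2⟩ | ⟨A, ⟨h1, h2⟩, rfl⟩)
      · exact ⟨h1, h2.trans (subset_insert _ _)⟩
      · exact ⟨h1.insert fun b hb => (mem_filter.1 (h2 hb)).2,
          insert_subset_insert _ (h2.trans (filter_subset _ _))⟩
  rw [e, card_union_of_disjoint, card_image_of_injOn]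
  · intro A hA C hC hAC
    have hA' : q ∉ A := fun h => hq (mem_filter.1 ((mem_filter.1 (mem_coe.1 hA)).2 h)).1
    have hC' : q ∉ C := fun h => hq (mem_filter.1 ((mem_filter.1 (mem_coe.1 hC)).2 h)).1
    have := congrArg (fun X => erase X q) hAC
    simpa [erase_insert hA', erase_insert hC'] using this
  · rw [disjoint_left]
    intro A hA hA'
    obtain ⟨C, hC, rfl⟩ := mem_image.1 hA'
    exact hq ((mem_filter.1 hA).2 (mem_insert_self _ _))

lemma cl_nbr_zero {U : Finset V} {q : V} (hq : q ∈ U) {r : ℕ} (h : cl G U (r+1) = 0) :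
    cl G (U.filter (G.Adj q)) r = 0 := by
  have h1 : q ∉ U.filter (G.Adj q) := by simp
  have h2 := cl_insert (G := G) h1 r
  have h3 := cl_mono (G := G) (insert_subset hq (filter_subset (G.Adj q) U)) (r+1)
  have h4 : (U.filter (G.Adj q)).filter (G.Adj q) = U.filter (G.Adj q) := by
    rw [filter_filter]; simp
  rw [h4] at h2
  omega

lemma graph_main (r : ℕ) : ∀ U : Finset V, cl G U (r+1) = 0 → ∀ k,
    mu r (k+1) (cl G U (k+1)) ≤ cl G U k := by
  induction r with
  | zero =>
    intro U _ k
    rw [mu_big _ _ _ (by omega)]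
    omega
  | succ r ih =>
    intro U hU k
    cases k with
    | zero => rw [cl_zero]; exact mu_one_le _ _
    | succ k =>
    rcases U.eq_empty_or_nonempty with rfl | hne
    · have : cl G (∅ : Finset V) (k+1+1) = 0 := by
        rw [cl_eq_zero]
        intro A hA hc
        have := hc.card_eq
        rw [subset_empty.1 hA] at this
        simp at this
      rw [this, mu_zero]
      omega
    obtain ⟨v0, hv0, hmax⟩ := exists_max_image U (fun v => cl G (U.filter (G.Adj v)) (k+1)) hne
    set M := U.filter (G.Adj v0) with hM
    set a := cl G M (k+1) with ha
    have hMz : cl G M (r+1) = 0 := cl_nbr_zero hv0 hU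
    have key : ∀ Q : Finset V, Q ⊆ U \ M → ∃ (s : ℕ) (l : ℕ → ℕ),
        (∀ j < s, l j ≤ a ∧ (l j = 0 ∨ k + 1 ≤ r)) ∧
        cl G (M ∪ Q) (k+2) = cl G M (k+2) + ∑ j ∈ range s, l j ∧
        a + ∑ j ∈ range s, mu r (k+1) (l j) ≤ cl G (M ∪ Q) (k+1) := by
      intro Q
      induction Q using Finset.induction_on with
      | empty => intro _; exact ⟨0, fun _ => 0, by simp, by simp, by simp [ha]⟩
      | insert q Q hq ihQ =>
        intro hQ
        obtain ⟨s, l, h1, h2, h3⟩ := ihQ ((subset_insert _ _).trans hQ)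
        obtain ⟨qU, qM⟩ := mem_sdiff.1 (hQ (mem_insert_self q Q))
        have hqW : q ∉ M ∪ Q := by simp [qM, hq]
        have hWU : M ∪ Q ⊆ U := union_subset (filter_subset _ _)
          ((subset_insert _ _).trans (hQ.trans sdiff_subset))
        have hsub : (M ∪ Q).filter (G.Adj q) ⊆ U.filter (G.Adj q) := filter_subset_filter _ hWU
        set W := (M ∪ Q).filter (G.Adj q) with hW
        have hWz : cl G W (r+1) = 0 := by
          have := cl_mono (G := G) hsub (r+1)
          have := cl_nbr_zero (G := G) qU hU
          omega
        have hcong : ∀ f : ℕ → ℕ, ∑ j ∈ range s, f (if j < s then l j else cl G W (k+1)) =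
            ∑ j ∈ range s, f (l j) := fun f =>
          sum_congr rfl fun j hj => by rw [if_pos (mem_range.1 hj)]
        refine ⟨s + 1, fun j => if j < s then l j else cl G W (k+1), ?_, ?_, ?_⟩
        · intro j hj
          by_cases hjs : j < s
          · simp only [hjs, if_true]; exact h1 j hjs
          · simp only [hjs, if_false]
            refine ⟨(cl_mono hsub _).trans (hmax q qU), ?_⟩
            by_cases hk : k + 1 ≤ r
            · exact Or.inr hk
            · exact Or.inl (cl_zero_le hWz (by omega))
        · rw [union_insert, cl_insert hqW, sum_range_succ, hcong (fun x => x), if_neg (by omega), h2, ← hW]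
          omega
        · rw [union_insert, cl_insert hqW, sum_range_succ, hcong (fun x => mu r (k+1) x), ← hW]
          simp only [lt_irrefl, if_false]
          have := ih W hWz k
          omega
    obtain ⟨s, l, h1, h2, h3⟩ := key (U \ M) subset_rfl
    rw [union_sdiff_of_subset (filter_subset _ _)] at h2 h3
    rw [h2]
    refine le_trans (num_bound r k a (cl G M (k+2)) s l (ih M hMz (k+1)) ?_
      (fun j hj => (h1 j hj).1) (fun j hj => (h1 j hj).2)) h3
    by_cases hk : k + 2 ≤ r
    · exact Or.inr hk
    · exact Or.inl (cl_zero_le hMz (by omega))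

lemma cl_univ (k : ℕ) : cl G univ k = (G.cliqueFinset k).card := by
  simp [cl]

lemma exists_families (r : ℕ) (hG : G.CliqueFree (r + 1)) :
    ∃ I : ℕ → Finset (Finset ℕ), (∀ k, ∀ A ∈ I k, Rb (r+1) (range r) k A) ∧
      (∀ k, (I k).card = (G.cliqueFinset k).card) ∧ (∀ k, (I (k+1)).shadow ⊆ I k) := by
  have hK : range r ⊆ range (r+1) := range_subset_range.2 (by omega)
  have hz : cl G (univ : Finset V) (r+1) = 0 := by
    rw [cl_eq_zero]; exact fun A _ => hG A
  have : ∀ k, ∃ I, Init (r+1) (range r) k I ∧ I.card = cl G univ k := by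
    intro k
    cases k with
    | zero =>
      refine ⟨{∅}, ⟨?_, ?_⟩, by rw [cl_zero]; simp⟩
      · intro A hA
        rw [mem_singleton.1 hA]
        exact ⟨by simp, by simp, by simp⟩
      · intro A _ C hC _
        exact mem_singleton.2 (card_eq_zero.1 hC.1)
    | succ k =>
      refine exists_init_size hK ?_
      rw [card_range]
      by_cases hk : k + 1 ≤ r
      · exact Or.inr hk
      · exact Or.inl (cl_zero_le hz (by omega))
  choose I h1 h2 using this
  refine ⟨I, fun k => (h1 k).1, fun k => by rw [h2, cl_univ], fun k => ?_⟩
  refine init_sub_of_card (init_shadow hK (h1 (k+1))) (h1 k) ?_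
  rw [(main_ffk (Nat.succ_pos r) r (k+1)).1 _ hK (card_range r) _ (h1 (k+1)), h2, h2]
  exact graph_main r univ hz k

end graph

lemma families_down {I : ℕ → Finset (Finset ℕ)} (hc : ∀ k, ∀ A ∈ I k, A.card = k)
    (hs : ∀ k, (I (k+1)).shadow ⊆ I k) (n : ℕ) : ∀ A ∈ I n, ∀ B ⊆ A, B ∈ I B.card := by
  induction n with
  | zero =>
    intro A hA B hB
    have := card_eq_zero.1 (hc 0 A hA)
    subst this
    rw [subset_empty.1 hB]
    exact hA
  | succ n ih =>
    intro A hA B hB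
    by_cases e : B = A
    · subst e; rw [hc _ _ hA]; exact hA
    · obtain ⟨a, ha, haB⟩ := exists_of_ssubset (hB.ssubset_of_ne e)
      refine ih (A.erase a) (hs n (mem_shadow_iff.2 ⟨A, hA, a, ha, rfl⟩)) B ?_
      exact subset_erase.2 ⟨hB, haB⟩

end Frohm

/-- For every finite simple graph `G` with no clique on `r+1` vertices, there is an
`r`-colorable simplicial complex `C` with `c_i(C) = c_i(G)` for all `i ≥ 0`. -/
theorem exists_colorable_complex_same_face_vector
    {V : Type*} [Fintype V] [DecidableEq V] (G : SimpleGraph V) [DecidableRel G.Adj]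
    (r : ℕ) (hG : G.CliqueFree (r + 1)) :
    ∃ (n : ℕ) (C : Finset (Finset (Fin n))),
      IsSimplicialComplex C ∧ ComplexColorable C r ∧
        ∀ i : ℕ, faceCount C i = (G.cliqueFinset i).card := by
  classical
  obtain ⟨I, h1, h2, h3⟩ := Frohm.exists_families r hG
  have hdown := Frohm.families_down (fun k A hA => (h1 k A hA).1) h3
  have hI0 : (∅ : Finset ℕ) ∈ I 0 := by
    have : (I 0).card = 1 := by
      rw [h2, ← Frohm.cl_univ, Frohm.cl_zero]
    obtain ⟨A, hA⟩ := Finset.card_eq_one.1 this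
    have hm : A ∈ I 0 := by rw [hA]; simp
    have := Finset.card_eq_zero.1 (h1 0 A hm).1
    rwa [this] at hm
  set U := (I 1).biUnion id with hU
  have hU1 : ∀ x ∈ U, {x} ∈ I 1 := by
    intro x hx
    obtain ⟨A, hA, hxA⟩ := Finset.mem_biUnion.1 hx
    have := hdown 1 A hA {x} (by simpa using hxA)
    simpa using this
  have hUm : ∀ k, ∀ A ∈ I k, ∀ x ∈ A, x ∈ U := by
    intro k A hA x hx
    have := hdown k A hA {x} (by simpa using hx)
    rw [Finset.card_singleton] at this
    exact Finset.mem_biUnion.2 ⟨{x}, this, by simp⟩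
  let e : Fin U.card ↪ ℕ := (U.orderEmbOfFin rfl).toEmbedding
  have heU : ∀ v, e v ∈ U := fun v => Finset.orderEmbOfFin_mem U rfl v
  have hsurj : ∀ x ∈ U, ∃ v, e v = x := by
    intro x hx
    have := Finset.range_orderEmbOfFin U rfl
    have hx' : x ∈ (U : Set ℕ) := hx
    rw [← this] at hx'
    exact hx'
  refine ⟨U.card, Finset.univ.filter (fun s => s.map e ∈ I s.card), ⟨?_, ?_, ?_⟩, ?_, ?_⟩
  · simpa using hI0
  · intro v
    simpa using hU1 _ (heU v)
  · intro s hs t ht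
    rw [Finset.mem_filter] at hs ⊢
    have := hdown _ _ hs.2 (t.map e) (Finset.map_subset_map.2 ht)
    rw [Finset.card_map] at this
    exact ⟨Finset.mem_univ _, this⟩
  · refine ⟨fun v => ⟨e v % (r+1), ?_⟩, ?_⟩
    · exact Finset.mem_range.1 ((h1 1 _ (hU1 _ (heU v))).2.1 (e v) (by simp))
    · intro s hs x hx y hy hxy
      have hs' := h1 _ _ (Finset.mem_filter.1 hs).2
      apply e.injective
      refine hs'.2.2 (e x) (Finset.mem_map_of_mem e hx) (e y) (Finset.mem_map_of_mem e hy) ?_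
      exact congrArg Fin.val hxy
  · intro i
    rw [← h2 i]
    unfold faceCount
    refine Finset.card_bij (fun s _ => s.map e) ?_ ?_ ?_
    · intro s hs
      simp only [Finset.mem_filter, Finset.mem_univ, true_and] at hs
      rw [← hs.2]; exact hs.1
    · intro s _ t _ hst
      exact Finset.map_injective e hst
    · intro A hA
      have hm : (Finset.univ.filter (fun v => e v ∈ A)).map e = A := by
        ext x
        simp only [Finset.mem_map, Finset.mem_filter, Finset.mem_univ, true_and]
        constructor
        · rintro ⟨v, hv, rfl⟩; exact hv
        · intro hx
          obtain ⟨v, rfl⟩ := hsurj x (hUm i A hA x hx)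
          exact ⟨v, hx, rfl⟩
      have hcd : (Finset.univ.filter (fun v => e v ∈ A)).card = i := by
        rw [← Finset.card_map e, hm, (h1 i A hA).1]
      refine ⟨Finset.univ.filter (fun v => e v ∈ A), ?_, hm⟩
      simp only [Finset.mem_filter, Finset.mem_univ, true_and]
      refine ⟨?_, hcd⟩
      rw [hcd, hm]; exact hA
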